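/- arXiv:2110.14178 — 3 statements merged into one kernel-verified Lean document; each statement's English description precedes it below -/
import Mathlib

section
/- Unconditionally, there exists T₀ ≥ 4 such that for every real T ≥ T₀ there exists s ∈ ℂ with ζ'(s) = 0, Re(s) > 1 and T ≤ Im(s) ≤ 2T; in particular there are infinitely many critical points of the Riemann zeta function with real part strictly greater than 1. -/
open Complex Filter Topology

/-- The continuous function `f` has mean value `c` over the windows `[T + 1, 2 T - 1]`. -/
def HasWindowMean (f : ℝ → ℂ) (c : ℂ) : Prop :=
  Continuous f ∧
    Tendsto (fun T : ℝ ↦ (T : ℂ)⁻¹ * ∫ t in (T + 1)..(2 * T - 1), f t) atTop (𝓝 c)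

namespace HasWindowMean

lemma add {f g : ℝ → ℂ} {a b : ℂ} (hf : HasWindowMean f a) (hg : HasWindowMean g b) :
    HasWindowMean (fun t ↦ f t + g t) (a + b) := by
  refine ⟨hf.1.add hg.1, (hf.2.add hg.2).congr fun T ↦ ?_⟩
  rw [intervalIntegral.integral_add (hf.1.intervalIntegrable _ _) (hg.1.intervalIntegrable _ _),
    mul_add]

lemma const_mul {f : ℝ → ℂ} {a : ℂ} (c : ℂ) (hf : HasWindowMean f a) :
    HasWindowMean (fun t ↦ c * f t) (c * a) := by
  refine ⟨hf.1.const_mul c, (hf.2.const_mul c).congr fun T ↦ ?_⟩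
  rw [intervalIntegral.integral_const_mul, mul_left_comm]

lemma sub {f g : ℝ → ℂ} {a b : ℂ} (hf : HasWindowMean f a) (hg : HasWindowMean g b) :
    HasWindowMean (fun t ↦ f t - g t) (a - b) := by
  simpa [sub_eq_add_neg] using hf.add (hg.const_mul (-1))

lemma zero : HasWindowMean (fun _ ↦ 0) 0 :=
  ⟨continuous_const, by simp⟩

lemma sum {ι : Type*} (s : Finset ι) {f : ι → ℝ → ℂ} {c : ι → ℂ}
    (h : ∀ i ∈ s, HasWindowMean (f i) (c i)) :
    HasWindowMean (fun t ↦ ∑ i ∈ s, f i t) (∑ i ∈ s, c i) := by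
  classical
  induction s using Finset.induction_on with
  | empty => simpa using zero
  | insert i s hi ih =>
    simp only [Finset.sum_insert hi]
    exact (h i (by simp)).add (ih fun j hj ↦ h j (by simp [hj]))

lemma one : HasWindowMean (fun _ ↦ 1) 1 := by
  refine ⟨continuous_const, ?_⟩
  have h : Tendsto (fun T : ℝ ↦ ((1 - 2 * T⁻¹ : ℝ) : ℂ)) atTop (𝓝 ((1 - 2 * 0 : ℝ) : ℂ)) :=
    (continuous_ofReal.tendsto _).comp
      (tendsto_const_nhds.sub (tendsto_inv_atTop_zero.const_mul 2))
  simp only [mul_zero, sub_zero, ofReal_one] at h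
  refine h.congr' ?_
  filter_upwards [eventually_gt_atTop 0] with T hT
  have : (T : ℂ) ≠ 0 := by exact_mod_cast hT.ne'
  simp only [intervalIntegral.integral_const, real_smul]
  push_cast
  field_simp
  ring

lemma exp_mul_I {ω : ℝ} (hω : ω ≠ 0) : HasWindowMean (fun t ↦ exp (ω * I * t)) 0 := by
  refine ⟨by fun_prop, ?_⟩
  have hc : (ω * I : ℂ) ≠ 0 := by simp [hω]
  have hn (x : ℝ) : ‖exp (ω * I * x)‖ = 1 := by
    rw [show (ω * I * x : ℂ) = ((ω * x : ℝ) : ℂ) * I by push_cast; ring, norm_exp_ofReal_mul_I]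
  have hlim : Tendsto (fun T : ℝ ↦ T⁻¹ * (2 / |ω|)) atTop (𝓝 0) := by
    simpa using tendsto_inv_atTop_zero.mul_const (2 / |ω|)
  refine squeeze_zero_norm' ?_ hlim
  filter_upwards [eventually_gt_atTop 0] with T hT
  rw [integral_exp_mul_complex hc, norm_mul, norm_inv, norm_div, norm_mul, norm_I, norm_real,
    norm_real, mul_one, Real.norm_eq_abs, Real.norm_eq_abs, abs_of_pos hT]
  gcongr
  refine (norm_sub_le _ _).trans ?_
  rw [hn, hn]
  norm_num

end HasWindowMean

/-- The twisted power `χ(n) n ^ (-it)`. -/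
noncomputable def twistedPow (χ : ℕ → ℂ) (n : ℕ) (t : ℝ) : ℂ :=
  χ n * (n : ℂ) ^ (-(t * I))

section twistedPow

variable {χ : ℕ → ℂ}

lemma norm_twistedPow (hχ : ∀ n ≠ 0, ‖χ n‖ = 1) {n : ℕ} (hn : n ≠ 0) (t : ℝ) :
    ‖twistedPow χ n t‖ = 1 := by
  rw [twistedPow, norm_mul, hχ n hn, norm_natCast_cpow_of_pos (Nat.pos_of_ne_zero hn)]
  simp

lemma twistedPow_mul (hχm : ∀ m n, m ≠ 0 → n ≠ 0 → χ (m * n) = χ m * χ n)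
    {m n : ℕ} (hm : m ≠ 0) (hn : n ≠ 0) (t : ℝ) :
    twistedPow χ (m * n) t = twistedPow χ m t * twistedPow χ n t := by
  rw [twistedPow, twistedPow, twistedPow, hχm m n hm hn, Nat.cast_mul, natCast_mul_natCast_cpow]
  ring

lemma twistedPow_eq_exp {n : ℕ} (hn : n ≠ 0) (t : ℝ) :
    twistedPow χ n t = χ n * exp (((-Real.log n : ℝ) : ℂ) * I * t) := by
  rw [twistedPow, cpow_def_of_ne_zero (by exact_mod_cast hn), ← natCast_log]
  congr 2
  push_cast
  ring

lemma hasWindowMean_twistedPow_mul_conj (hχ : ∀ n ≠ 0, ‖χ n‖ = 1) {m n : ℕ} (hm : m ≠ 0)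
    (hn : n ≠ 0) :
    HasWindowMean (fun t ↦ twistedPow χ m t * (starRingEnd ℂ) (twistedPow χ n t))
      (if m = n then 1 else 0) := by
  split_ifs with h
  · subst h
    convert HasWindowMean.one using 2 with t
    rw [mul_conj, normSq_eq_norm_sq, norm_twistedPow hχ hm]
    simp
  · have hω : Real.log n - Real.log m ≠ 0 := by
      rw [sub_ne_zero]
      intro h'
      apply h
      have := Real.log_injOn_pos (Set.mem_Ioi.2 (by positivity)) (Set.mem_Ioi.2 (by positivity)) h'
      exact_mod_cast this.symm
    convert (HasWindowMean.exp_mul_I hω).const_mul (χ m * (starRingEnd ℂ) (χ n)) using 2 with t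
    · rw [twistedPow_eq_exp hm, twistedPow_eq_exp hn, map_mul, ← exp_conj, mul_mul_mul_comm,
        ← exp_add]
      congr 2
      simp only [map_mul, conj_ofReal, conj_I]
      push_cast
      ring
    · simp

end twistedPow

lemma card_divisors_filter_not_dvd_le {M p k : ℕ} (hp : p.Prime) (hM : M ≠ 0) (hk : p ^ k ∣ M) :
    (k + 1) * (M.divisors.filter (fun m ↦ ¬ p ∣ m)).card ≤ M.divisors.card := by
  rw [← Finset.card_range (k + 1), ← Finset.card_product]
  refine Finset.card_le_card_of_injOn (fun x ↦ p ^ x.1 * x.2) ?_ ?_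
  · rintro ⟨j, m⟩ h
    simp only [Finset.coe_product, Set.mem_prod, Finset.mem_coe, Finset.mem_range,
      Finset.mem_filter, Nat.mem_divisors] at h ⊢
    refine ⟨Nat.Coprime.mul_dvd_of_dvd_of_dvd ?_ ?_ h.2.1.1, hM⟩
    · exact Nat.Coprime.pow_left _ ((Nat.Prime.coprime_iff_not_dvd hp).2 h.2.2)
    · exact (pow_dvd_pow _ (by omega)).trans hk
  · rintro ⟨j, m⟩ h ⟨j', m'⟩ h' e
    simp only [Finset.coe_product, Set.mem_prod, Finset.mem_coe, Finset.mem_range,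
      Finset.mem_filter, Nat.mem_divisors] at h h' e
    have hj : j = j' := by
      have := congrArg (fun n ↦ n.factorization p) e
      have hm0 : m ≠ 0 := fun h0 ↦ h.2.2 (h0 ▸ dvd_zero p)
      have hm0' : m' ≠ 0 := fun h0 ↦ h'.2.2 (h0 ▸ dvd_zero p)
      simpa [Nat.factorization_mul, hp.ne_zero, hm0, hm0', hp.factorization_self,
        Nat.factorization_eq_zero_of_not_dvd h.2.2,
        Nat.factorization_eq_zero_of_not_dvd h'.2.2] using this
    subst hj
    simpa [hp.ne_zero] using e

section Kronecker

variable {χ : ℕ → ℂ}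

/-- A weighted mean argument: a suitable Fejér-type weight makes all the twisted prime powers
close to `1` on average. -/
lemma eventually_exists_sum_one_sub_re_lt (hχ : ∀ n ≠ 0, ‖χ n‖ = 1)
    (hχm : ∀ m n, m ≠ 0 → n ≠ 0 → χ (m * n) = χ m * χ n) (P : Finset ℕ)
    (hP : ∀ p ∈ P, p.Prime) {ε : ℝ} (hε : 0 < ε) :
    ∀ᶠ T : ℝ in atTop, ∃ t ∈ Set.Icc (T + 1) (2 * T - 1),
      ∑ p ∈ P, (1 - (twistedPow χ p t).re) < ε := by
  obtain ⟨k, hk⟩ := exists_nat_gt ((P.card : ℝ) / ε)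
  set M := (∏ p ∈ P, p) ^ k with hMdef
  have hM : M ≠ 0 := pow_ne_zero _ (Finset.prod_ne_zero_iff.2 fun p hp ↦ (hP p hp).ne_zero)
  set S := M.divisors with hS
  have hS0 {m : ℕ} (hm : m ∈ S) : m ≠ 0 := (Nat.pos_of_mem_divisors hm).ne'
  set x := twistedPow χ with hx
  set W : ℝ → ℂ := fun t ↦ ∑ m ∈ S, ∑ n ∈ S, x m t * (starRingEnd ℂ) (x n t) with hW
  have hWsq (t : ℝ) : W t = ((‖∑ m ∈ S, x m t‖ ^ 2 : ℝ) : ℂ) := by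
    rw [← normSq_eq_norm_sq, ← mul_conj, map_sum, Finset.sum_mul_sum]
  have hWmean : HasWindowMean W (S.card : ℂ) := by
    convert HasWindowMean.sum S fun m hm ↦ HasWindowMean.sum S fun n hn ↦
      hasWindowMean_twistedPow_mul_conj hχ (hS0 hm) (hS0 hn) using 1
    simp
  have hWxmean (p : ℕ) (hp : p.Prime) : HasWindowMean (fun t ↦ x p t * W t)
      ((S.filter (fun m ↦ p ∣ m)).card : ℂ) := by
    have := HasWindowMean.sum S fun m hm ↦ HasWindowMean.sum S fun n hn ↦
      hasWindowMean_twistedPow_mul_conj hχ (mul_ne_zero hp.ne_zero (hS0 hm)) (hS0 hn)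
    convert this using 1
    · funext t
      simp only [hW, Finset.mul_sum]
      refine Finset.sum_congr rfl fun m hm ↦ Finset.sum_congr rfl fun n hn ↦ ?_
      rw [twistedPow_mul hχm hp.ne_zero (hS0 hm), mul_assoc]
    · rw [Finset.sum_comm, Finset.card_filter, Nat.cast_sum]
      refine Finset.sum_congr rfl fun n hn ↦ ?_
      by_cases h : p ∣ n
      · obtain ⟨c, rfl⟩ := h
        have hc : c ∈ S := by
          rw [hS, Nat.mem_divisors] at hn ⊢
          exact ⟨(Dvd.intro_left p rfl).trans hn.1, hM⟩
        simp [hp.ne_zero, hc]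
      · have (m : ℕ) : p * m ≠ n := fun e ↦ h ⟨m, e.symm⟩
        simp [h, this]
  have hmean := (HasWindowMean.sum P fun p hp ↦ hWmean.sub (hWxmean p (hP p hp))).sub
    (hWmean.const_mul (ε : ℂ))
  set c : ℂ := ∑ p ∈ P, ((S.card : ℂ) - ((S.filter (fun m ↦ p ∣ m)).card : ℂ)) -
    (ε : ℂ) * (S.card : ℂ) with hc
  have hcneg : c.re < 0 := by
    have hbound (p : ℕ) (hp : p ∈ P) :
        (S.card : ℝ) - ((S.filter (fun m ↦ p ∣ m)).card : ℝ) ≤ S.card / (k + 1) := by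
      have h1 := card_divisors_filter_not_dvd_le (hP p hp) hM
        (pow_dvd_pow_of_dvd (Finset.dvd_prod_of_mem (fun p ↦ p) hp) k)
      have h2 := Finset.card_filter_add_card_filter_not (s := S) (fun m ↦ p ∣ m)
      rw [le_div_iff₀ (by positivity)]
      have h1' : ((k : ℝ) + 1) * ((S.filter (fun m ↦ ¬ p ∣ m)).card : ℝ) ≤ S.card := by
        exact_mod_cast h1
      have h2' : ((S.filter (fun m ↦ p ∣ m)).card : ℝ) +
          ((S.filter (fun m ↦ ¬ p ∣ m)).card : ℝ) = S.card := by exact_mod_cast h2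
      rw [← h2', add_sub_cancel_left, h2', mul_comm]
      exact h1'
    have hSpos : (0 : ℝ) < S.card := by
      exact_mod_cast Finset.card_pos.2 ⟨1, by simp [hS, hM]⟩
    have hre : c.re = ∑ p ∈ P, ((S.card : ℝ) - ((S.filter (fun m ↦ p ∣ m)).card : ℝ)) -
        ε * S.card := by
      simp [hc]
    rw [hre]
    have h3 := Finset.sum_le_sum hbound
    rw [Finset.sum_const, nsmul_eq_mul] at h3
    have h4 : (P.card : ℝ) < ε * (k + 1) := by
      rw [div_lt_iff₀ hε] at hk
      nlinarith
    have h5 : (P.card : ℝ) * (S.card / (k + 1)) < ε * S.card := by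
      rw [mul_div_assoc', div_lt_iff₀ (by positivity)]
      nlinarith
    linarith
  have hev := (continuous_re.tendsto _).comp hmean.2
  filter_upwards [hev.eventually_lt_const hcneg, eventually_ge_atTop 2] with T hT hT2
  by_contra! hcon
  refine hT.not_ge ?_
  simp only [Function.comp_apply]
  rw [← ofReal_inv, re_ofReal_mul]
  refine mul_nonneg (by positivity) ?_
  have hint := hmean.1.intervalIntegrable (μ := MeasureTheory.volume) (T + 1) (2 * T - 1)
  have hre := intervalIntegral.intervalIntegral_re (𝕜 := ℂ) hint
  simp only [RCLike.re_to_complex] at hre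
  rw [← hre]
  refine intervalIntegral.integral_nonneg (by linarith) fun t ht ↦ ?_
  have key : (∑ p ∈ P, (W t - x p t * W t) - ε * W t) =
      ((‖∑ m ∈ S, x m t‖ ^ 2 : ℝ) : ℂ) * (∑ p ∈ P, (1 - x p t) - ε) := by
    rw [← hWsq]
    generalize W t = V
    rw [mul_sub, Finset.mul_sum, mul_comm V]
    exact congrArg (· - (ε : ℂ) * V) (Finset.sum_congr rfl fun _ _ ↦ by ring)
  rw [key, re_ofReal_mul]
  refine mul_nonneg (by positivity) ?_
  have := hcon t ht
  simp only [sub_re, re_sum, one_re, ofReal_re]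
  linarith

lemma norm_twistedPow_sub_one_sq (hχ : ∀ n ≠ 0, ‖χ n‖ = 1) {n : ℕ} (hn : n ≠ 0) (t : ℝ) :
    ‖twistedPow χ n t - 1‖ ^ 2 = 2 * (1 - (twistedPow χ n t).re) := by
  have h := norm_twistedPow hχ hn t
  have h' : normSq (twistedPow χ n t) = 1 := by rw [normSq_eq_norm_sq, h, one_pow]
  rw [← normSq_eq_norm_sq, normSq_sub, h']
  simp
  ring

lemma one_sub_re_twistedPow_nonneg (hχ : ∀ n ≠ 0, ‖χ n‖ = 1) {n : ℕ} (hn : n ≠ 0) (t : ℝ) :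
    0 ≤ 1 - (twistedPow χ n t).re := by
  have := norm_twistedPow_sub_one_sq hχ hn t
  nlinarith [sq_nonneg ‖twistedPow χ n t - 1‖]

lemma tendsto_twistedPow_of_forall_prime {u : ℕ → ℝ} (hχ : ∀ n ≠ 0, ‖χ n‖ = 1)
    (hχm : ∀ m n, m ≠ 0 → n ≠ 0 → χ (m * n) = χ m * χ n)
    (hu : ∀ p : ℕ, p.Prime → Tendsto (fun k ↦ twistedPow χ p (u k)) atTop (𝓝 1)) {n : ℕ}
    (hn : n ≠ 0) : Tendsto (fun k ↦ twistedPow χ n (u k)) atTop (𝓝 1) := by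
  induction n using induction_on_primes with
  | zero => exact absurd rfl hn
  | one =>
    have h1 : χ 1 = 1 := by
      have h := hχm 1 1 one_ne_zero one_ne_zero
      have h0 : χ 1 ≠ 0 := norm_ne_zero_iff.1 (by rw [hχ 1 one_ne_zero]; exact one_ne_zero)
      rw [mul_one] at h
      exact (mul_eq_left₀ h0).1 h.symm
    simp [twistedPow, h1]
  | prime_mul p m hp ih =>
    have hm : m ≠ 0 := right_ne_zero_of_mul hn
    simp_rw [twistedPow_mul hχm hp.ne_zero hm]
    simpa using (hu p hp).mul (ih hm)

lemma eventually_exists_tsum_mul_norm_twistedPow_sub_one_lt (hχ : ∀ n ≠ 0, ‖χ n‖ = 1)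
    (hχm : ∀ m n, m ≠ 0 → n ≠ 0 → χ (m * n) = χ m * χ n) {w : ℕ → ℝ} (hw : ∀ n, 0 ≤ w n)
    (hw0 : w 0 = 0) (hws : Summable w) {δ : ℝ} (hδ : 0 < δ) :
    ∀ᶠ T : ℝ in atTop, ∃ t ∈ Set.Icc (T + 1) (2 * T - 1),
      ∑' n, w n * ‖twistedPow χ n t - 1‖ < δ := by
  have hK (k : ℕ) := eventually_exists_sum_one_sub_re_lt hχ hχm
    ((Finset.range k).filter Nat.Prime) (fun p hp ↦ (Finset.mem_filter.1 hp).2)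
    (Nat.one_div_pos_of_nat (α := ℝ) (n := k))
  by_contra hcon
  rw [not_eventually] at hcon
  have hex (k : ℕ) := (hcon.and_eventually (hK k)).exists
  choose T hT₁ t ht hts using hex
  have hprime (p : ℕ) (hp : p.Prime) :
      Tendsto (fun k ↦ twistedPow χ p (t k)) atTop (𝓝 1) := by
    rw [tendsto_iff_norm_sub_tendsto_zero]
    have hsq : Tendsto (fun k ↦ ‖twistedPow χ p (t k) - 1‖ ^ 2) atTop (𝓝 0) := by
      have hlim : Tendsto (fun k : ℕ ↦ 2 * (1 / ((k : ℝ) + 1))) atTop (𝓝 0) := by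
        simpa using (tendsto_one_div_add_atTop_nhds_zero_nat (𝕜 := ℝ)).const_mul 2
      refine squeeze_zero' (Eventually.of_forall fun _ ↦ by positivity) ?_ hlim
      filter_upwards [eventually_gt_atTop p] with k hk
      rw [norm_twistedPow_sub_one_sq hχ hp.ne_zero]
      have := Finset.single_le_sum (f := fun p ↦ 1 - (twistedPow χ p (t k)).re)
        (s := (Finset.range k).filter Nat.Prime)
        (fun q hq ↦ one_sub_re_twistedPow_nonneg hχ (Finset.mem_filter.1 hq).2.ne_zero _)
        (Finset.mem_filter.2 ⟨Finset.mem_range.2 hk, hp⟩)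
      have := hts k
      linarith
    simpa using hsq.sqrt
  have hlim : Tendsto (fun k ↦ ∑' n, w n * ‖twistedPow χ n (t k) - 1‖) atTop (𝓝 0) := by
    rw [← tsum_zero (α := ℝ) (β := ℕ)]
    refine tendsto_tsum_of_dominated_convergence (hws.mul_right 2) (fun n ↦ ?_)
      (Eventually.of_forall fun k n ↦ ?_)
    · rcases eq_or_ne n 0 with rfl | hn
      · simp [hw0]
      · have h := tendsto_twistedPow_of_forall_prime hχ hχm hprime hn
        simpa using ((h.sub_const 1).norm).const_mul (w n)
    · rcases eq_or_ne n 0 with rfl | hn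
      · simp [hw0]
      · rw [Real.norm_eq_abs, abs_of_nonneg (mul_nonneg (hw n) (norm_nonneg _))]
        refine mul_le_mul_of_nonneg_left ((norm_sub_le _ _).trans ?_) (hw n)
        rw [norm_twistedPow hχ hn, norm_one]
        norm_num
  obtain ⟨k, hk⟩ := (hlim.eventually_lt_const hδ).exists
  exact hT₁ k ⟨t k, ht k, hk⟩

end Kronecker

open ArithmeticFunction in
/-- The completely multiplicative sign which is `1` at `2` and `-1` at every odd prime. -/
noncomputable def oddPrimeSign (n : ℕ) : ℝ :=
  (-1) ^ (cardFactors n + n.factorization 2)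

lemma oddPrimeSign_mul {m n : ℕ} (hm : m ≠ 0) (hn : n ≠ 0) :
    oddPrimeSign (m * n) = oddPrimeSign m * oddPrimeSign n := by
  rw [oddPrimeSign, oddPrimeSign, oddPrimeSign, ArithmeticFunction.cardFactors_mul hm hn,
    Nat.factorization_mul hm hn, Finsupp.add_apply, ← pow_add]
  congr 1
  ring

lemma abs_oddPrimeSign (n : ℕ) : |oddPrimeSign n| = 1 := by
  simp [oddPrimeSign]

lemma oddPrimeSign_two : oddPrimeSign 2 = 1 := by
  simp [oddPrimeSign, ArithmeticFunction.cardFactors_apply_prime Nat.prime_two,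
    Nat.prime_two.factorization_self]

lemma oddPrimeSign_of_prime {p : ℕ} (hp : p.Prime) (hp2 : p ≠ 2) : oddPrimeSign p = -1 := by
  simp [oddPrimeSign, ArithmeticFunction.cardFactors_apply_prime hp, hp.factorization, hp2]

section LSeries

open ArithmeticFunction

/-- The coefficients of the negative logarithmic derivative of the `L`-series of
`oddPrimeSign`. -/
noncomputable def signedVonMangoldt (n : ℕ) : ℂ := ((oddPrimeSign n * vonMangoldt n : ℝ) : ℂ)

lemma norm_signedVonMangoldt (n : ℕ) : ‖signedVonMangoldt n‖ = vonMangoldt n := by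
  rw [signedVonMangoldt, norm_real, Real.norm_eq_abs, abs_mul, abs_oddPrimeSign, one_mul,
    abs_of_nonneg vonMangoldt_nonneg]

lemma LSeriesSummable_signedVonMangoldt {s : ℂ} (hs : 1 < s.re) :
    LSeriesSummable signedVonMangoldt s := by
  refine (LSeriesSummable_vonMangoldt hs).norm.of_norm_bounded fun n ↦ LSeries.norm_term_le s ?_
  rw [norm_signedVonMangoldt, norm_real, Real.norm_eq_abs]
  exact le_abs_self _

lemma abscissaOfAbsConv_signedVonMangoldt_le : LSeries.abscissaOfAbsConv signedVonMangoldt ≤ 1 :=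
  LSeries.abscissaOfAbsConv_le_of_forall_lt_LSeriesSummable fun y hy ↦
    LSeriesSummable_signedVonMangoldt (by simpa using hy)

lemma abscissaOfAbsConv_vonMangoldt_le :
    LSeries.abscissaOfAbsConv (fun n ↦ (vonMangoldt n : ℂ)) ≤ 1 :=
  LSeries.abscissaOfAbsConv_le_of_forall_lt_LSeriesSummable fun y hy ↦
    LSeriesSummable_vonMangoldt (by simpa using hy)

lemma differentiableOn_LSeries_of_abscissaOfAbsConv_le_one {f : ℕ → ℂ}
    (hf : LSeries.abscissaOfAbsConv f ≤ 1) :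
    DifferentiableOn ℂ (LSeries f) {s | 1 < s.re} :=
  (LSeries_differentiableOn f).mono fun s hs ↦ hf.trans_lt (by exact_mod_cast hs)

lemma summable_vonMangoldt_div_rpow {x : ℝ} (hx : 1 < x) :
    Summable fun n : ℕ ↦ vonMangoldt n / (n : ℝ) ^ x := by
  refine (LSeriesSummable_vonMangoldt (s := x) (by simpa using hx)).norm.congr fun n ↦ ?_
  rcases eq_or_ne n 0 with rfl | hn
  · simp
  · rw [LSeries.norm_term_eq, if_neg hn, norm_real, Real.norm_eq_abs,
      abs_of_nonneg vonMangoldt_nonneg, ofReal_re]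

lemma LSeries_signedVonMangoldt_ofReal (x : ℝ) :
    LSeries signedVonMangoldt x =
      ((∑' n : ℕ, oddPrimeSign n * vonMangoldt n / (n : ℝ) ^ x : ℝ) : ℂ) := by
  rw [LSeries, ofReal_tsum]
  refine tsum_congr fun n ↦ ?_
  rcases eq_or_ne n 0 with rfl | hn
  · simp
  · rw [LSeries.term_of_ne_zero hn, signedVonMangoldt, ofReal_div, ofReal_cpow n.cast_nonneg,
      ofReal_natCast]

lemma exists_LSeries_signedVonMangoldt_re_neg :
    ∃ x : ℝ, 1 < x ∧ (LSeries signedVonMangoldt x).re < 0 := by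
  obtain ⟨C, hC⟩ := vonMangoldt.LSeries_residueClass_lower_bound (q := 1) (a := 1) isUnit_one
  have hres (n : ℕ) : vonMangoldt.residueClass (1 : ZMod 1) n = vonMangoldt n :=
    Set.indicator_of_mem (s := {n : ℕ | (n : ZMod 1) = 1}) (Subsingleton.elim (n : ZMod 1) 1) _
  have hb := vonMangoldt.summable_residueClass_non_primes_div (1 : ZMod 1)
  simp only [hres] at hC hb
  set b : ℕ → ℝ := fun n ↦ (if n.Prime then 0 else vonMangoldt n) / n +
    (if n = 2 then vonMangoldt n / n else 0) with hbdef
  have hbs : Summable b := hb.add (summable_of_ne_finset_zero (s := {2}) fun n hn ↦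
    if_neg (by simpa using hn))
  set B := ∑' n, b n
  set D := |C| + |2 * B| + 1
  have hD : 1 ≤ D := le_add_of_nonneg_left (by positivity)
  refine ⟨1 + 1 / D, by simp; positivity, ?_⟩
  set x := 1 + 1 / D with hx
  have hx1 : 1 < x := by simp [hx]; positivity
  have hx2 : x ≤ 2 := by
    have : 1 / D ≤ 1 := (div_le_one (by positivity)).2 hD
    linarith
  have hlow := hC ⟨hx1, hx2⟩
  have hxD : ((Nat.totient 1 : ℕ) : ℝ)⁻¹ / (x - 1) = D := by simp [hx]
  rw [hxD] at hlow
  rw [LSeries_signedVonMangoldt_ofReal, ofReal_re]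
  have hΛs := summable_vonMangoldt_div_rpow hx1
  have hle (n : ℕ) : oddPrimeSign n * vonMangoldt n / (n : ℝ) ^ x ≤
      2 * b n - vonMangoldt n / (n : ℝ) ^ x := by
    rcases eq_or_ne n 0 with rfl | hn
    · simp [hbdef]
    have hn1 : (1 : ℝ) ≤ n := by exact_mod_cast Nat.one_le_iff_ne_zero.2 hn
    have hpow : vonMangoldt n / (n : ℝ) ^ x ≤ vonMangoldt n / n := by
      refine div_le_div_of_nonneg_left vonMangoldt_nonneg (by positivity) ?_
      simpa using Real.rpow_le_rpow_of_exponent_le hn1 hx1.le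
    have h0 : 0 ≤ vonMangoldt n / (n : ℝ) ^ x := div_nonneg vonMangoldt_nonneg (by positivity)
    have h0' := h0.trans hpow
    rw [mul_div_assoc]
    have hs := (le_abs_self _).trans (abs_oddPrimeSign n).le
    have hs' := mul_le_mul_of_nonneg_right hs h0
    by_cases hp : n.Prime
    · by_cases h2 : n = 2
      · simp only [hbdef, if_pos hp, if_pos h2, zero_div, zero_add]
        linarith
      · rw [oddPrimeSign_of_prime hp h2]
        simp [hbdef, hp, h2]
    · have h2 : n ≠ 2 := fun h ↦ hp (h ▸ Nat.prime_two)
      simp only [hbdef, if_neg hp, if_neg h2, add_zero]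
      linarith
  have hsum : Summable fun n : ℕ ↦ oddPrimeSign n * vonMangoldt n / (n : ℝ) ^ x := by
    refine hΛs.of_norm_bounded fun n ↦ ?_
    rw [mul_div_assoc, norm_mul, Real.norm_eq_abs, abs_oddPrimeSign, one_mul, Real.norm_eq_abs,
      abs_of_nonneg (div_nonneg vonMangoldt_nonneg (by positivity))]
  have htot := hsum.tsum_le_tsum hle ((hbs.mul_left 2).sub hΛs)
  rw [(hbs.mul_left 2).tsum_sub hΛs, tsum_mul_left] at htot
  have := le_abs_self C
  have := le_abs_self (2 * B)
  have hDdef : D = |C| + |2 * B| + 1 := rfl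
  linarith

lemma exists_LSeries_signedVonMangoldt_re_pos :
    ∃ x : ℝ, 1 < x ∧ 0 < (LSeries signedVonMangoldt x).re := by
  have h := LSeries.tendsto_cpow_mul_atTop (f := signedVonMangoldt) (n := 1)
    (fun m hm ↦ by interval_cases m <;> simp [signedVonMangoldt])
    (abscissaOfAbsConv_signedVonMangoldt_le.trans_lt (by exact EReal.coe_lt_top 1))
  have h2 : 0 < (signedVonMangoldt (1 + 1)).re := by
    rw [signedVonMangoldt, ofReal_re, one_add_one_eq_two, oddPrimeSign_two, one_mul,
      vonMangoldt_apply_prime Nat.prime_two]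
    exact Real.log_pos (by norm_num)
  obtain ⟨x, hx, hx1⟩ := ((((continuous_re.tendsto _).comp h).eventually_const_lt h2).and
    (eventually_gt_atTop 1)).exists
  refine ⟨x, hx1, ?_⟩
  have h3 : (((1 : ℕ) : ℂ) + 1) ^ (x : ℂ) = (((2 : ℝ) ^ x : ℝ) : ℂ) := by
    rw [ofReal_cpow (by norm_num)]
    norm_num
  simp only [Function.comp_apply] at hx
  rw [h3, re_ofReal_mul] at hx
  exact pos_of_mul_pos_right hx (by positivity)

lemma exists_LSeries_signedVonMangoldt_eq_zero :
    ∃ x : ℝ, 1 < x ∧ LSeries signedVonMangoldt x = 0 := by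
  obtain ⟨a, ha, ha'⟩ := exists_LSeries_signedVonMangoldt_re_neg
  obtain ⟨b, hb, hb'⟩ := exists_LSeries_signedVonMangoldt_re_pos
  have hcont : ContinuousOn (fun x : ℝ ↦ (LSeries signedVonMangoldt x).re) (Set.Ioi 1) :=
    continuous_re.comp_continuousOn
      ((differentiableOn_LSeries_of_abscissaOfAbsConv_le_one
        abscissaOfAbsConv_signedVonMangoldt_le).continuousOn.comp
          continuous_ofReal.continuousOn fun x hx ↦ by simpa using hx)
  obtain ⟨x, hx, hx0⟩ := isPreconnected_Ioi.intermediate_value ha hb hcont ⟨ha'.le, hb'.le⟩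
  refine ⟨x, hx, ?_⟩
  simp only [LSeries_signedVonMangoldt_ofReal, ofReal_re] at hx0
  rw [LSeries_signedVonMangoldt_ofReal, hx0, ofReal_zero]

lemma norm_LSeries_vonMangoldt_sub_le {σ t : ℝ} (hσ : 1 < σ) {z : ℂ} (hz : σ ≤ z.re) :
    ‖LSeries (fun n ↦ (vonMangoldt n : ℂ)) (z + t * I) - LSeries signedVonMangoldt z‖ ≤
      ∑' n : ℕ, vonMangoldt n / (n : ℝ) ^ σ *
        ‖twistedPow (fun n ↦ (oddPrimeSign n : ℂ)) n t - 1‖ := by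
  have hz1 : 1 < z.re := hσ.trans_le hz
  have hzt : 1 < (z + t * I).re := by simpa using hz1
  have h1 : LSeriesSummable _ _ := LSeriesSummable_vonMangoldt hzt
  have h2 : LSeriesSummable _ _ := LSeriesSummable_signedVonMangoldt hz1
  have hχ : ∀ n ≠ 0, ‖((oddPrimeSign n : ℝ) : ℂ)‖ = 1 := fun n _ ↦ by
    rw [norm_real, Real.norm_eq_abs, abs_oddPrimeSign]
  have hsum : Summable fun n : ℕ ↦ vonMangoldt n / (n : ℝ) ^ σ *
      ‖twistedPow (fun n ↦ (oddPrimeSign n : ℂ)) n t - 1‖ := by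
    refine ((summable_vonMangoldt_div_rpow hσ).mul_right 2).of_nonneg_of_le
      (fun n ↦ by positivity [vonMangoldt_nonneg (n := n)]) fun n ↦ ?_
    rcases eq_or_ne n 0 with rfl | hn
    · simp
    refine mul_le_mul_of_nonneg_left ((norm_sub_le _ _).trans ?_)
      (div_nonneg vonMangoldt_nonneg (by positivity))
    rw [norm_twistedPow hχ hn, norm_one]
    norm_num
  rw [LSeries, LSeries, ← h1.tsum_sub h2]
  refine tsum_of_norm_bounded hsum.hasSum fun n ↦ ?_
  rcases eq_or_ne n 0 with rfl | hn
  · simp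
  have hn0 : (n : ℂ) ≠ 0 := by exact_mod_cast hn
  have hn1 : (1 : ℝ) ≤ n := by exact_mod_cast Nat.one_le_iff_ne_zero.2 hn
  have hsq : ((oddPrimeSign n : ℝ) : ℂ) * oddPrimeSign n = 1 := by
    rw [← ofReal_mul, ← abs_mul_abs_self, abs_oddPrimeSign]
    simp
  have key : LSeries.term (fun n ↦ (vonMangoldt n : ℂ)) (z + t * I) n -
      LSeries.term signedVonMangoldt z n =
      (oddPrimeSign n : ℂ) * ((vonMangoldt n : ℂ) / (n : ℂ) ^ z) *
        (twistedPow (fun n ↦ (oddPrimeSign n : ℂ)) n t - 1) := by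
    rw [LSeries.term_of_ne_zero hn, LSeries.term_of_ne_zero hn, signedVonMangoldt, twistedPow,
      cpow_add _ _ hn0, cpow_neg, ofReal_mul]
    have : (n : ℂ) ^ (t * I) ≠ 0 := by simp [cpow_eq_zero_iff, hn0]
    have : (n : ℂ) ^ z ≠ 0 := by simp [cpow_eq_zero_iff, hn0]
    field_simp
    linear_combination -(vonMangoldt n : ℂ) * hsq
  rw [key, norm_mul, norm_mul, hχ n hn, one_mul, norm_div, norm_real, Real.norm_eq_abs,
    abs_of_nonneg vonMangoldt_nonneg, norm_natCast_cpow_of_pos (Nat.pos_of_ne_zero hn)]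
  gcongr

lemma exists_sphere_LSeries_signedVonMangoldt_ne_zero {x : ℝ} (hx : 1 < x) :
    ∃ r : ℝ, 0 < r ∧ r ≤ 1 ∧ 1 < x - r ∧
      ∀ z ∈ Metric.sphere (x : ℂ) r, LSeries signedVonMangoldt z ≠ 0 := by
  have hopen : IsOpen {s : ℂ | 1 < s.re} := isOpen_lt continuous_const continuous_re
  have han := (differentiableOn_LSeries_of_abscissaOfAbsConv_le_one
    abscissaOfAbsConv_signedVonMangoldt_le).analyticOnNhd hopen
  have hxU : (x : ℂ) ∈ {s : ℂ | 1 < s.re} := by simpa using hx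
  rcases (han x hxU).eventually_eq_zero_or_eventually_ne_zero with h | h
  · obtain ⟨y, hy, hy'⟩ := exists_LSeries_signedVonMangoldt_re_neg
    have := han.eqOn_zero_of_preconnected_of_eventuallyEq_zero
      (convex_halfSpace_re_gt 1).isPreconnected hxU h (x := (y : ℂ)) (by simpa using hy)
    rw [this] at hy'
    simp at hy'
  · rw [eventually_nhdsWithin_iff, Metric.eventually_nhds_iff] at h
    obtain ⟨ε, hε, h⟩ := h
    refine ⟨min (ε / 2) (min 1 ((x - 1) / 2)), ?_, ?_, ?_, fun z hz ↦ ?_⟩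
    · exact lt_min (by linarith) (lt_min one_pos (by linarith))
    · exact (min_le_right _ _).trans (min_le_left _ _)
    · have := (min_le_right (ε / 2) _).trans (min_le_right 1 ((x - 1) / 2))
      linarith
    · have hpos : 0 < min (ε / 2) (min 1 ((x - 1) / 2)) :=
        lt_min (by linarith) (lt_min one_pos (by linarith))
      rw [Metric.mem_sphere] at hz
      refine h ?_ (dist_pos.1 (hz ▸ hpos))
      rw [hz]
      exact (min_le_left _ _).trans_lt (by linarith)

/-- A Hurwitz-type principle: if `g` is uniformly close on a closed disc to a function which
vanishes at the centre and is bounded below on the boundary, then `g` has a zero in the disc. -/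
lemma exists_zero_mem_closedBall_of_norm_sub_lt {f g : ℂ → ℂ} {c : ℂ} {r δ : ℝ} (hr : 0 < r)
    (hδ : 0 < δ) (hg : DifferentiableOn ℂ g (Metric.closedBall c r)) (hfc : f c = 0)
    (hf : ∀ z ∈ Metric.sphere c r, 4 * δ ≤ ‖f z‖)
    (hfg : ∀ z ∈ Metric.closedBall c r, ‖g z - f z‖ < δ) :
    ∃ z ∈ Metric.closedBall c r, g z = 0 := by
  have hcl : DiffContOnCl ℂ g (Metric.ball c r) := by
    refine DifferentiableOn.diffContOnCl ?_
    rwa [closure_ball c hr.ne']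
  have hgc : ‖g c‖ < δ := by simpa [hfc] using hfg c (Metric.mem_closedBall_self hr.le)
  have hsph : ∀ z ∈ Metric.sphere c r, 2 * δ ≤ ‖g z - g c‖ := fun z hz ↦ by
    have h1 := hfg z (Metric.sphere_subset_closedBall hz)
    have h2 := hf z hz
    have h3 : ‖f z‖ ≤ ‖g z - g c‖ + ‖g z - f z‖ + ‖g c‖ := by
      calc ‖f z‖ = ‖(g z - g c) - (g z - f z) + g c‖ := by congr 1; ring
        _ ≤ _ := (norm_add_le _ _).trans (add_le_add_left (norm_sub_le _ _) _)
    linarith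
  have hnc : ∃ᶠ z in 𝓝 c, g z ≠ g c := by
    intro hcon
    simp only [not_not] at hcon
    have han := (hg.mono Metric.ball_subset_closedBall).analyticOnNhd Metric.isOpen_ball
    have heq := han.eqOn_of_preconnected_of_eventuallyEq
      (analyticOnNhd_const (v := g c)) (convex_ball c r).isPreconnected
      (Metric.mem_ball_self hr) hcon
    have heq' := heq.of_subset_closure hg.continuousOn continuousOn_const
      Metric.ball_subset_closedBall (closure_ball c hr.ne').ge
    obtain ⟨z, hz⟩ := (NormedSpace.sphere_nonempty (x := c)).2 hr.le
    have := hsph z hz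
    rw [heq' (Metric.sphere_subset_closedBall hz), sub_self, norm_zero] at this
    linarith
  obtain ⟨z, hz, hz0⟩ := hcl.ball_subset_image_closedBall hr hsph hnc
    (show (0 : ℂ) ∈ Metric.ball (g c) (2 * δ / 2) by
      rw [Metric.mem_ball, dist_zero_left]
      linarith)
  exact ⟨z, hz, hz0⟩

end LSeries

/-- For every sufficiently large `T` the Riemann zeta function has a critical point `s`
(`ζ'(s) = 0`) with `Re s > 1` and `T ≤ Im s ≤ 2T`; in particular there are infinitely many
critical points of `ζ` with real part strictly greater than `1`. -/
theorem exists_critical_point_right_of_one :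
    ∃ T₀ : ℝ, 4 ≤ T₀ ∧
      ∀ T : ℝ, T₀ ≤ T →
        ∃ s : ℂ, deriv riemannZeta s = 0 ∧ 1 < s.re ∧ T ≤ s.im ∧ s.im ≤ 2 * T := by
  obtain ⟨x, hx, hx0⟩ := exists_LSeries_signedVonMangoldt_eq_zero
  obtain ⟨r, hr, hr1, hxr, hsph⟩ := exists_sphere_LSeries_signedVonMangoldt_ne_zero hx
  have hball {z : ℂ} (hz : z ∈ Metric.closedBall (x : ℂ) r) :
      x - r ≤ z.re ∧ -1 ≤ z.im ∧ z.im ≤ 1 := by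
    rw [Metric.mem_closedBall, dist_eq] at hz
    have h1 := abs_le.1 ((abs_re_le_norm _).trans hz)
    have h2 := abs_le.1 ((abs_im_le_norm _).trans hz)
    simp only [sub_re, ofReal_re, sub_im, ofReal_im, sub_zero] at h1 h2
    exact ⟨by linarith, by linarith, by linarith⟩
  have hcont : ContinuousOn (fun z ↦ ‖LSeries signedVonMangoldt z‖)
      (Metric.sphere (x : ℂ) r) :=
    ((differentiableOn_LSeries_of_abscissaOfAbsConv_le_one
      abscissaOfAbsConv_signedVonMangoldt_le).continuousOn.mono fun z hz ↦
        hxr.trans_le (hball (Metric.sphere_subset_closedBall hz)).1).norm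
  obtain ⟨z₀, hz₀, hmin⟩ := (isCompact_sphere (x : ℂ) r).exists_isMinOn
    ((NormedSpace.sphere_nonempty (x := (x : ℂ))).2 hr.le) hcont
  have hδ : 0 < ‖LSeries signedVonMangoldt z₀‖ / 4 := by
    have := norm_pos_iff.2 (hsph z₀ hz₀)
    positivity
  have hev := eventually_exists_tsum_mul_norm_twistedPow_sub_one_lt
    (χ := fun n ↦ (oddPrimeSign n : ℂ))
    (fun n _ ↦ by rw [norm_real, Real.norm_eq_abs, abs_oddPrimeSign])
    (fun m n hm hn ↦ by rw [oddPrimeSign_mul hm hn, ofReal_mul])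
    (w := fun n ↦ ArithmeticFunction.vonMangoldt n / (n : ℝ) ^ (x - r))
    (fun n ↦ div_nonneg ArithmeticFunction.vonMangoldt_nonneg (by positivity)) (by simp)
    (summable_vonMangoldt_div_rpow hxr) hδ
  obtain ⟨T₁, hT₁⟩ := eventually_atTop.1 hev
  refine ⟨max 4 T₁, le_max_left _ _, fun T hT ↦ ?_⟩
  obtain ⟨t, ht, hlt⟩ := hT₁ T ((le_max_right _ _).trans hT)
  have hdiff : DifferentiableOn ℂ
      (fun z ↦ LSeries (fun n ↦ (ArithmeticFunction.vonMangoldt n : ℂ)) (z + t * I))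
      (Metric.closedBall (x : ℂ) r) :=
    (differentiableOn_LSeries_of_abscissaOfAbsConv_le_one
      abscissaOfAbsConv_vonMangoldt_le).comp (by fun_prop) fun z hz ↦ by
        simpa using hxr.trans_le (hball hz).1
  obtain ⟨z, hz, hz0⟩ := exists_zero_mem_closedBall_of_norm_sub_lt
    (f := LSeries signedVonMangoldt) hr hδ hdiff hx0
    (fun z hz ↦ by
      have : ‖LSeries signedVonMangoldt z₀‖ ≤ ‖LSeries signedVonMangoldt z‖ := hmin hz
      linarith)
    (fun z hz ↦ (norm_LSeries_vonMangoldt_sub_le hxr (hball hz).1).trans_lt hlt)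
  obtain ⟨hre, him, him'⟩ := hball hz
  have hs : 1 < (z + t * I).re := by simpa using hxr.trans_le hre
  refine ⟨z + t * I, ?_, hs, ?_, ?_⟩
  · rw [ArithmeticFunction.LSeries_vonMangoldt_eq_deriv_riemannZeta_div hs, div_eq_zero_iff,
      neg_eq_zero] at hz0
    exact hz0.resolve_right (riemannZeta_ne_zero_of_one_lt_re hs)
  · simp only [add_im, mul_im, ofReal_re, I_im, ofReal_im, I_re]
    linarith [ht.1]
  · simp only [add_im, mul_im, ofReal_re, I_im, ofReal_im, I_re]
    linarith [ht.2]
end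

section
/- There exists a constant C > 0 (depending only on q and χ) such that for every real x ≥ 3 and every s ∈ ℂ with Re(s) ≥ 1, one has Re(∑_{1 < n ≤ x} Λ(n)·χ(n)/(n^s·log n)) ≥ −log(log x) − C₀ + log(π²/6) + ∑_{p prime, p ∣ q} log((p+1)/p) − C/log x. -/
open Complex DirichletCharacter Finset

open ArithmeticFunction in
theorem sum_log_eq_sum_vonMangoldt_mul_div (N : ℕ) :
    ∑ m ∈ Ioc 0 N, Real.log m = ∑ d ∈ Ioc 0 N, Λ d * ((N / d : ℕ) : ℝ) := by
  simpa [vonMangoldt_mul_zeta] using sum_Ioc_mul_zeta_eq_sum vonMangoldt N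

theorem sum_log_eq_log_factorial (N : ℕ) :
    ∑ m ∈ Ioc 0 N, Real.log m = Real.log N.factorial := by
  induction N with
  | zero => simp
  | succ n ih =>
    rw [Finset.sum_Ioc_succ_top (Nat.zero_le n), ih, Nat.factorial_succ, Nat.cast_mul,
      Real.log_mul (by positivity) (by positivity), add_comm]

open ArithmeticFunction in
/-- Mertens' first theorem. -/
theorem abs_sum_vonMangoldt_div_sub_log_le {N : ℕ} (hN : N ≠ 0) :
    |∑ n ∈ Ioc 0 N, Λ n / n - Real.log N| ≤ Real.log 4 + 4 := by
  have hN0 : (0 : ℝ) < N := by positivity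
  have h4 : 0 ≤ Real.log 4 := Real.log_nonneg (by norm_num)
  have hlogN : 0 ≤ Real.log N := Real.log_natCast_nonneg N
  have key := (sum_log_eq_log_factorial N).symm.trans (sum_log_eq_sum_vonMangoldt_mul_div N)
  have hst := Stirling.le_log_factorial_stirling hN
  have h2pi : 0 ≤ Real.log (2 * Real.pi) := Real.log_nonneg (by linarith [Real.pi_gt_three])
  have hup : Real.log N.factorial ≤ N * Real.log N := by
    rw [← Real.log_pow]
    exact Real.log_le_log (by positivity) (mod_cast Nat.factorial_le_pow N)
  have hlow : Real.log N.factorial ≤ N * ∑ n ∈ Ioc 0 N, Λ n / n := by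
    rw [key, mul_sum]
    refine sum_le_sum fun d _ => ?_
    calc Λ d * ((N / d : ℕ) : ℝ) ≤ Λ d * (N / d) :=
          mul_le_mul_of_nonneg_left Nat.cast_div_le vonMangoldt_nonneg
      _ = _ := by ring
  have hpsi : ∑ n ∈ Ioc 0 N, Λ n ≤ (Real.log 4 + 4) * N := by
    simpa [Chebyshev.psi] using Chebyshev.psi_le_const_mul_self hN0.le
  have hupp : N * ∑ n ∈ Ioc 0 N, Λ n / n ≤ Real.log N.factorial + ∑ n ∈ Ioc 0 N, Λ n := by
    rw [key, mul_sum, ← sum_add_distrib]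
    refine sum_le_sum fun d hd => ?_
    have hd0 : 0 < d := (mem_Ioc.mp hd).1
    have h1 : (N : ℝ) / d ≤ ((N / d : ℕ) : ℝ) + 1 := by
      rw [div_le_iff₀ (by positivity)]
      exact_mod_cast (Nat.lt_mul_of_div_lt (Nat.lt_succ_self (N / d)) hd0).le.trans_eq
        (by simp [Nat.succ_eq_add_one])
    calc N * (Λ d / d) = Λ d * (N / d) := by ring
      _ ≤ Λ d * (((N / d : ℕ) : ℝ) + 1) := mul_le_mul_of_nonneg_left h1 vonMangoldt_nonneg
      _ = _ := by ring
  rw [abs_le]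
  constructor
  · refine le_of_mul_le_mul_left ?_ hN0
    nlinarith
  · refine le_of_mul_le_mul_left ?_ hN0
    nlinarith

/-- The partial sums of `∑ Λ(n) / (n log n)`. -/
noncomputable def vonMangoldtLogSum (N : ℕ) : ℝ :=
  ∑ n ∈ Ioc 0 N, ArithmeticFunction.vonMangoldt n / (n * Real.log n)

theorem exists_abs_vonMangoldtLogSum_sub_le :
    ∃ c K : ℝ, 0 ≤ K ∧ ∀ N : ℕ, 2 ≤ N →
      |vonMangoldtLogSum N - Real.log (Real.log N) - c| ≤ K / Real.log N := by
  set K : ℝ := Real.log 4 + 4 with hK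
  have hK0 : 0 ≤ K := add_nonneg (Real.log_nonneg (by norm_num)) (by norm_num)
  set R : ℕ → ℝ := fun N => ∑ n ∈ Ioc 0 N, ArithmeticFunction.vonMangoldt n / n - Real.log N
    with hR
  have hRb : ∀ N : ℕ, N ≠ 0 → |R N| ≤ K := fun N hN => abs_sum_vonMangoldt_div_sub_log_le hN
  have hlogpos : ∀ n : ℕ, 0 < Real.log (n + 2 : ℕ) := fun n =>
    Real.log_pos (by push_cast; linarith [Nat.cast_nonneg (α := ℝ) n])
  set D : ℕ → ℝ := fun n => vonMangoldtLogSum (n + 2) - Real.log (Real.log (n + 2 : ℕ)) -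
    R (n + 2) / Real.log (n + 2 : ℕ) with hD
  have hstep : ∀ n, |D (n + 1) - D n| ≤
      (K + 1) * (1 / Real.log (n + 2 : ℕ) - 1 / Real.log (n + 1 + 2 : ℕ)) := by
    intro n
    have ha := hlogpos n
    have hb := hlogpos (n + 1)
    have hab : Real.log (n + 2 : ℕ) ≤ Real.log (n + 1 + 2 : ℕ) :=
      Real.log_le_log (by positivity) (by push_cast; linarith)
    have hba : Real.log (n + 1 + 2 : ℕ) - Real.log (n + 2 : ℕ) ≤ 1 := by
      rw [← Real.log_div (by positivity) (by positivity)]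
      refine (Real.log_le_sub_one_of_pos (by positivity)).trans ?_
      rw [sub_le_iff_le_add, div_le_iff₀ (by positivity)]
      push_cast; linarith [Nat.cast_nonneg (α := ℝ) n]
    have hG : vonMangoldtLogSum (n + 1 + 2) = vonMangoldtLogSum (n + 2) +
        (R (n + 1 + 2) - R (n + 2) + (Real.log (n + 1 + 2 : ℕ) - Real.log (n + 2 : ℕ))) /
          Real.log (n + 1 + 2 : ℕ) := by
      have hS (f : ℕ → ℝ) : ∑ k ∈ Ioc 0 (n + 1 + 2), f k =
          ∑ k ∈ Ioc 0 (n + 2), f k + f (n + 1 + 2) := sum_Ioc_succ_top (Nat.zero_le _) f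
      simp only [hR, vonMangoldtLogSum, hS]
      rw [← div_div]
      congr 2
      ring
    have hRn := hRb (n + 2) (by omega)
    simp only [hD]
    rw [hG]
    generalize Real.log (n + 1 + 2 : ℕ) = b at *
    generalize Real.log (n + 2 : ℕ) = a at *
    generalize R (n + 1 + 2) = r' at *
    generalize R (n + 2) = r at *
    have hinv : 0 ≤ 1 / a - 1 / b := sub_nonneg.2 (one_div_le_one_div_of_le ha hab)
    have h1 : Real.log b - Real.log a ≤ (b - a) / a := by
      rw [← Real.log_div hb.ne' ha.ne']
      refine (Real.log_le_sub_one_of_pos (by positivity)).trans_eq ?_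
      field_simp
    have h2 : (b - a) / b ≤ Real.log b - Real.log a := by
      have := Real.log_le_sub_one_of_pos (div_pos ha hb)
      rw [Real.log_div ha.ne' hb.ne'] at this
      have e : (b - a) / b = -(a / b - 1) := by field_simp; ring
      linarith
    have h3 : (b - a) / a - (b - a) / b ≤ 1 / a - 1 / b := by
      calc (b - a) / a - (b - a) / b = (b - a) * (1 / a - 1 / b) := by ring
        _ ≤ 1 * (1 / a - 1 / b) := mul_le_mul_of_nonneg_right hba hinv
        _ = _ := one_mul _
    have h4 := mul_le_mul_of_nonneg_right (abs_le.1 hRn).1 hinv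
    have h5 := mul_le_mul_of_nonneg_right (abs_le.1 hRn).2 hinv
    rw [abs_le]
    ring_nf at *
    constructor <;> linarith
  have hanti : Antitone fun n => D n + (K + 1) / Real.log (n + 2 : ℕ) :=
    antitone_nat_of_succ_le fun n => by
      have := (abs_le.1 (hstep n)).2
      rw [mul_sub, mul_one_div, mul_one_div] at this
      linarith
  have hmono : Monotone fun n => D n - (K + 1) / Real.log (n + 2 : ℕ) :=
    monotone_nat_of_le_succ fun n => by
      have := (abs_le.1 (hstep n)).1
      rw [mul_sub, mul_one_div, mul_one_div] at this
      linarith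
  have hle : ∀ m n, D m - (K + 1) / Real.log (m + 2 : ℕ) ≤ D n + (K + 1) / Real.log (n + 2 : ℕ) := by
    intro m n
    have h1 := hmono (le_max_left m n)
    have h2 := hanti (le_max_right m n)
    have h3 : 0 ≤ (K + 1) / Real.log (max m n + 2 : ℕ) := div_nonneg (by linarith) (hlogpos _).le
    simp only at h1 h2
    linarith
  refine ⟨⨆ m, (D m - (K + 1) / Real.log (m + 2 : ℕ)), 2 * K + 1, by linarith, ?_⟩
  intro N hN
  obtain ⟨n, rfl⟩ := Nat.exists_eq_add_of_le' hN
  have hup := ciSup_le fun m => hle m n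
  have hlo : D n - (K + 1) / Real.log (n + 2 : ℕ) ≤ ⨆ m, (D m - (K + 1) / Real.log (m + 2 : ℕ)) :=
    le_ciSup (f := fun m => D m - (K + 1) / Real.log (m + 2 : ℕ))
      ⟨_, by rintro _ ⟨m, rfl⟩; exact hle m 0⟩ n
  have hRn : |R (n + 2) / Real.log (n + 2 : ℕ)| ≤ K / Real.log (n + 2 : ℕ) := by
    rw [abs_div, abs_of_pos (hlogpos n)]
    exact div_le_div_of_nonneg_right (hRb _ (by omega)) (hlogpos n).le
  have e : (2 * K + 1) / Real.log (n + 2 : ℕ) =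
    K / Real.log (n + 2 : ℕ) + (K + 1) / Real.log (n + 2 : ℕ) := by ring
  rw [e, abs_le]
  rw [abs_le] at hRn
  simp only [hD] at hup hlo
  constructor <;> linarith [hRn.1, hRn.2]

theorem exists_abs_vonMangoldtLogSum_floor_sub_le :
    ∃ c K : ℝ, 0 ≤ K ∧ ∀ t : ℝ, 2 ≤ t →
      |vonMangoldtLogSum ⌊t⌋₊ - Real.log (Real.log t) - c| ≤ K / Real.log t := by
  obtain ⟨c, K, hK, h⟩ := exists_abs_vonMangoldtLogSum_sub_le
  refine ⟨c, 2 * K + 2, by linarith, fun t ht => ?_⟩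
  have hN : 2 ≤ ⌊t⌋₊ := Nat.le_floor (by exact_mod_cast ht)
  have hN' : (2 : ℝ) ≤ (⌊t⌋₊ : ℝ) := by exact_mod_cast hN
  have hNt : (⌊t⌋₊ : ℝ) ≤ t := Nat.floor_le (by linarith)
  have htN : t < ⌊t⌋₊ + 1 := Nat.lt_floor_add_one t
  have hcN := h ⌊t⌋₊ hN
  generalize (⌊t⌋₊ : ℝ) = n at *
  have hn : 0 < Real.log n := Real.log_pos (by linarith)
  have ht0 : 0 < Real.log t := Real.log_pos (by linarith)
  have hle : Real.log n ≤ Real.log t := Real.log_le_log (by linarith) hNt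
  have hhalf : Real.log t ≤ 2 * Real.log n := by
    have : Real.log t ≤ Real.log (n ^ 2) := Real.log_le_log (by linarith) (by nlinarith)
    simpa [Real.log_pow] using this
  have hdiff : Real.log t - Real.log n ≤ 1 := by
    rw [← Real.log_div (by linarith) (by linarith)]
    refine (Real.log_le_sub_one_of_pos (by positivity)).trans ?_
    rw [sub_le_iff_le_add, div_le_iff₀ (by positivity)]
    linarith
  have hll : Real.log (Real.log n) ≤ Real.log (Real.log t) := Real.log_le_log hn hle
  have hll' : Real.log (Real.log t) - Real.log (Real.log n) ≤ 1 / Real.log n := by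
    rw [← Real.log_div ht0.ne' hn.ne']
    refine (Real.log_le_sub_one_of_pos (by positivity)).trans ?_
    rw [sub_le_iff_le_add, div_le_iff₀ hn]
    field_simp
    linarith
  have hinv : 1 / Real.log n ≤ 2 / Real.log t := by
    rw [div_le_div_iff₀ hn ht0]; linarith
  have e1 : (2 * K + 2) / Real.log t = K * (2 / Real.log t) + 2 / Real.log t := by ring
  have e2 : K / Real.log n ≤ K * (2 / Real.log t) := by
    rw [← mul_one_div]; exact mul_le_mul_of_nonneg_left hinv hK
  rw [e1]
  rw [abs_le] at *
  constructor <;> linarith [hcN.1, hcN.2]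

theorem integral_log_mul_exp_neg :
    ∫ u in Set.Ioi (0 : ℝ), Real.log u * Real.exp (-u) = -Real.eulerMascheroniConstant := by
  have h1 := Complex.hasDerivAt_GammaIntegral (s := 1) (by simp)
  have h2 : HasDerivAt Complex.GammaIntegral (-Real.eulerMascheroniConstant : ℂ) 1 := by
    refine Complex.hasDerivAt_Gamma_one.congr_of_eventuallyEq ?_
    have : ∀ᶠ s : ℂ in nhds 1, 0 < s.re :=
      Complex.continuous_re.continuousAt.eventually (lt_mem_nhds (by simp))
    filter_upwards [this] with s hs using (Complex.Gamma_eq_integral hs).symm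
  have h3 := h1.unique h2
  simp only [sub_self, Complex.cpow_zero, one_mul, ← Complex.ofReal_mul, ← Complex.ofReal_neg]
    at h3
  rw [integral_complex_ofReal] at h3
  exact_mod_cast h3

theorem integrableOn_log_mul_exp_neg :
    MeasureTheory.IntegrableOn (fun u => Real.log u * Real.exp (-u)) (Set.Ioi (0 : ℝ)) := by
  by_contra h
  have := integral_log_mul_exp_neg
  rw [MeasureTheory.integral_undef h] at this
  linarith [Real.one_half_lt_eulerMascheroniConstant]

theorem vonMangoldt_div_mul_log_nonneg (n : ℕ) :
    0 ≤ ArithmeticFunction.vonMangoldt n / (n * Real.log n) :=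
  div_nonneg ArithmeticFunction.vonMangoldt_nonneg
    (mul_nonneg n.cast_nonneg (Real.log_natCast_nonneg n))

theorem vonMangoldtLogSum_isBigO {r : ℝ} (hr : 0 < r) :
    vonMangoldtLogSum =O[Filter.atTop] fun n : ℕ => (n : ℝ) ^ r := by
  obtain ⟨c, K, hK, h⟩ := exists_abs_vonMangoldtLogSum_sub_le
  have h1 : vonMangoldtLogSum =O[Filter.atTop] fun n : ℕ => Real.log n := by
    refine Asymptotics.IsBigO.of_bound (1 + |c| / Real.log 2 + K / Real.log 2 / Real.log 2) ?_
    filter_upwards [Filter.eventually_ge_atTop 3] with n hn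
    have hn3 : (3 : ℝ) ≤ n := by exact_mod_cast hn
    have h2 : 0 < Real.log 2 := Real.log_pos (by norm_num)
    have hlog2 : Real.log 2 ≤ Real.log n := Real.log_le_log (by norm_num) (by linarith)
    have hl1 : 1 ≤ Real.log n := by
      rw [Real.le_log_iff_exp_le (by linarith)]
      linarith [Real.exp_one_lt_d9]
    have hll0 : 0 ≤ Real.log (Real.log n) := Real.log_nonneg hl1
    have hll : Real.log (Real.log n) ≤ Real.log n :=
      (Real.log_le_sub_one_of_pos (by linarith)).trans (by linarith)
    have hc := h n (by omega)
    have h3 : K / Real.log n ≤ K / Real.log 2 := div_le_div_of_nonneg_left hK h2 hlog2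
    have h4 : ∀ y : ℝ, 0 ≤ y → y ≤ y / Real.log 2 * Real.log n := fun y hy => by
      rw [div_mul_eq_mul_div, le_div_iff₀ h2]
      exact mul_le_mul_of_nonneg_left hlog2 hy
    have h5 := h4 |c| (abs_nonneg c)
    have h6 := h4 (K / Real.log 2) (by positivity)
    rw [Real.norm_eq_abs, Real.norm_of_nonneg (by linarith)]
    have h7 : |vonMangoldtLogSum n| ≤ |vonMangoldtLogSum n - Real.log (Real.log n) - c| +
        Real.log (Real.log n) + |c| := by
      calc |vonMangoldtLogSum n|
          = |(vonMangoldtLogSum n - Real.log (Real.log n) - c) + Real.log (Real.log n) + c| := by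
            congr 1; ring
        _ ≤ _ := (abs_add_three _ _ _).trans_eq (by rw [abs_of_nonneg hll0])
    linarith
  exact h1.trans ((isLittleO_log_rpow_atTop hr).isBigO.comp_tendsto tendsto_natCast_atTop_atTop)

theorem log_riemannZeta_one_add_eq_integral {δ : ℝ} (hδ : 0 < δ) :
    Real.log (riemannZeta ((1 + δ : ℝ) : ℂ)).re =
      δ * ∫ t in Set.Ioi (1 : ℝ), vonMangoldtLogSum ⌊t⌋₊ * t ^ (-(δ + 1)) := by
  have h := LSeries_eq_mul_integral_of_nonneg
    (fun n => ArithmeticFunction.vonMangoldt n / (n * Real.log n)) (r := δ / 2) (s := (δ : ℂ))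
    (by positivity) (by simpa using hδ) (vonMangoldtLogSum_isBigO (by positivity))
    vonMangoldt_div_mul_log_nonneg
  rw [log_riemannZeta_eq (by linarith)]
  apply Complex.ofReal_injective
  rw [LSeries_def₀ (by simp)] at h
  rw [Complex.ofReal_tsum, Complex.ofReal_mul]
  have e1 : ∑' n : ℕ, ((ArithmeticFunction.vonMangoldt n / ((n : ℝ) ^ (1 + δ) * Real.log n) : ℝ)
      : ℂ) = ∑' n : ℕ, ((ArithmeticFunction.vonMangoldt n / (n * Real.log n) : ℝ) : ℂ)
        / (n : ℂ) ^ (δ : ℂ) := by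
    refine tsum_congr fun n => ?_
    rcases Nat.eq_zero_or_pos n with rfl | hn
    · simp
    · rw [Real.rpow_add (by positivity), Real.rpow_one]
      push_cast [Complex.ofReal_cpow n.cast_nonneg]
      rw [div_div]
      ring_nf
  rw [e1, h, ← integral_complex_ofReal]
  congr 1
  refine MeasureTheory.setIntegral_congr_fun measurableSet_Ioi fun t ht => ?_
  have ht0 : (0 : ℝ) ≤ t := le_of_lt (lt_trans one_pos ht)
  simp only [vonMangoldtLogSum]
  push_cast [Complex.ofReal_cpow ht0]
  rfl

theorem log_riemannZeta_one_add_eq_integral_exp {δ : ℝ} (hδ : 0 < δ) :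
    Real.log (riemannZeta ((1 + δ : ℝ) : ℂ)).re =
      ∫ u in Set.Ioi (0 : ℝ), vonMangoldtLogSum ⌊Real.exp (u / δ)⌋₊ * Real.exp (-u) := by
  have himg : (fun u => Real.exp (u / δ)) '' Set.Ioi 0 = Set.Ioi 1 := by
    ext t
    constructor
    · rintro ⟨u, hu, rfl⟩
      exact Real.one_lt_exp_iff.2 (div_pos hu hδ)
    · intro ht
      refine ⟨δ * Real.log t, mul_pos hδ (Real.log_pos ht), ?_⟩
      simp only
      rw [mul_div_cancel_left₀ _ hδ.ne', Real.exp_log (one_pos.trans ht)]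
  have hder : ∀ u ∈ Set.Ioi (0 : ℝ), HasDerivWithinAt (fun u => Real.exp (u / δ))
      (Real.exp (u / δ) * (1 / δ)) (Set.Ioi 0) u := fun u _ =>
    ((hasDerivAt_id' u).div_const δ).exp.hasDerivWithinAt
  have hinj : Set.InjOn (fun u => Real.exp (u / δ)) (Set.Ioi 0) := fun u _ v _ h => by
    have := Real.exp_injective h
    field_simp at this
    exact this
  rw [log_riemannZeta_one_add_eq_integral hδ, ← himg,
    MeasureTheory.integral_image_eq_integral_abs_deriv_smul measurableSet_Ioi hder hinj,
    ← MeasureTheory.integral_const_mul]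
  refine MeasureTheory.setIntegral_congr_fun measurableSet_Ioi fun u _ => ?_
  simp only [smul_eq_mul]
  rw [abs_of_pos (by positivity), ← Real.exp_mul]
  have e : Real.exp (u / δ) * Real.exp (u / δ * -(δ + 1)) = Real.exp (-u) := by
    rw [← Real.exp_add]; congr 1; field_simp; ring
  rw [← e]
  field_simp

theorem vonMangoldtLogSum_eq_zero {N : ℕ} (hN : N < 2) : vonMangoldtLogSum N = 0 := by
  interval_cases N <;> simp [vonMangoldtLogSum]

open Filter Topology in
theorem tendsto_log_riemannZeta_add_log :
    Tendsto (fun δ : ℝ => Real.log (riemannZeta ((1 + δ : ℝ) : ℂ)).re + Real.log δ)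
      (𝓝[>] 0) (𝓝 0) := by
  have h1 : Tendsto (fun δ : ℝ => ((1 + δ : ℝ) : ℂ)) (𝓝[>] 0) (𝓝[≠] 1) := by
    refine tendsto_nhdsWithin_iff.2 ⟨?_, ?_⟩
    · have : Continuous fun δ : ℝ => ((1 + δ : ℝ) : ℂ) := by fun_prop
      simpa using (this.tendsto 0).mono_left nhdsWithin_le_nhds
    · filter_upwards [self_mem_nhdsWithin] with δ hδ
      have : δ ≠ 0 := ne_of_gt hδ
      simpa using this
  have h2 : Tendsto (fun δ : ℝ => δ * (riemannZeta ((1 + δ : ℝ) : ℂ)).re) (𝓝[>] 0) (𝓝 1) := by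
    have := (Complex.continuous_re.tendsto _).comp (riemannZeta_residue_one.comp h1)
    simpa [Function.comp_def] using this
  have h3 : Tendsto (fun δ : ℝ => Real.log (δ * (riemannZeta ((1 + δ : ℝ) : ℂ)).re))
      (𝓝[>] 0) (𝓝 0) := by
    simpa using h2.log one_ne_zero
  refine h3.congr' ?_
  filter_upwards [self_mem_nhdsWithin, h2.eventually_ne one_ne_zero] with δ hδ hne
  rw [Real.log_mul (left_ne_zero_of_mul hne) (right_ne_zero_of_mul hne), add_comm]

open Filter Topology MeasureTheory in
/-- The constant in Mertens' second theorem, in terms of prime powers. -/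
theorem vonMangoldtLogSum_constant_eq_eulerMascheroni {c K : ℝ} (hK : 0 ≤ K) (h : ∀ t : ℝ, 2 ≤ t →
      |vonMangoldtLogSum ⌊t⌋₊ - Real.log (Real.log t) - c| ≤ K / Real.log t) :
    c = Real.eulerMascheroniConstant := by
  have h2 : 0 < Real.log 2 := Real.log_pos (by norm_num)
  set B : ℝ := K / Real.log 2 + |c| with hB
  have hB0 : 0 ≤ B := by positivity
  have hE : IntegrableOn (fun u : ℝ => Real.exp (-u)) (Set.Ioi 0) := integrableOn_exp_neg_Ioi 0
  set F : ℝ → ℝ → ℝ := fun δ u =>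
    (vonMangoldtLogSum ⌊Real.exp (u / δ)⌋₊ - Real.log u + Real.log δ) * Real.exp (-u) with hF
  have hmeas : ∀ δ, AEStronglyMeasurable (F δ) (volume.restrict (Set.Ioi 0)) := fun δ => by
    have : Measurable fun u : ℝ => vonMangoldtLogSum ⌊Real.exp (u / δ)⌋₊ :=
      (measurable_from_nat (f := vonMangoldtLogSum)).comp (by fun_prop)
    have h' : Measurable (F δ) := by
      simp only [hF]
      fun_prop
    exact h'.aestronglyMeasurable
  have hbound : ∀ δ : ℝ, 0 < δ → δ < 1 → ∀ u : ℝ, 0 < u →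
      ‖F δ u‖ ≤ B * Real.exp (-u) + ‖Real.log u * Real.exp (-u)‖ := by
    intro δ hδ hδ1 u hu
    simp only [hF]
    rw [norm_mul, norm_mul, Real.norm_of_nonneg (Real.exp_nonneg _), ← add_mul]
    refine mul_le_mul_of_nonneg_right ?_ (Real.exp_nonneg _)
    rw [Real.norm_eq_abs, Real.norm_eq_abs]
    rcases le_or_gt 2 (Real.exp (u / δ)) with hexp | hexp
    · have h3 := h _ hexp
      rw [Real.log_exp, Real.log_div hu.ne' hδ.ne'] at h3
      have h4 : Real.log 2 ≤ u / δ := (Real.log_le_iff_le_exp two_pos).2 hexp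
      have h5 : K / (u / δ) ≤ K / Real.log 2 := div_le_div_of_nonneg_left hK h2 h4
      generalize vonMangoldtLogSum ⌊Real.exp (u / δ)⌋₊ = g at *
      have e : g - Real.log u + Real.log δ = (g - (Real.log u - Real.log δ) - c) + c := by ring
      rw [e]
      refine (abs_add_le _ _).trans ?_
      linarith [abs_nonneg (Real.log u)]
    · have h3 : ⌊Real.exp (u / δ)⌋₊ < 2 := by
        rw [Nat.floor_lt (Real.exp_nonneg _)]; exact_mod_cast hexp
      have h4 : u / δ < 1 := by
        rw [← Real.lt_log_iff_exp_lt two_pos] at hexp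
        linarith [Real.log_two_lt_d9]
      have h5 : Real.log u ≤ Real.log δ :=
        Real.log_le_log hu (by rw [div_lt_one hδ] at h4; exact h4.le)
      have h6 : Real.log δ ≤ 0 := Real.log_nonpos hδ.le hδ1.le
      rw [vonMangoldtLogSum_eq_zero h3, abs_of_nonneg (by linarith),
        abs_of_nonpos (h5.trans h6)]
      linarith
  have hbint : IntegrableOn (fun u : ℝ => B * Real.exp (-u) + ‖Real.log u * Real.exp (-u)‖)
      (Set.Ioi 0) := (hE.const_mul B).add integrableOn_log_mul_exp_neg.norm
  have hsmall : ∀ᶠ δ : ℝ in 𝓝[>] 0, 0 < δ ∧ δ < 1 :=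
    Eventually.and self_mem_nhdsWithin (mem_nhdsWithin_of_mem_nhds (gt_mem_nhds one_pos))
  have hlim : Tendsto (fun δ => ∫ u in Set.Ioi 0, F δ u) (𝓝[>] 0)
      (𝓝 (∫ u in Set.Ioi 0, c * Real.exp (-u))) := by
    refine tendsto_integral_filter_of_dominated_convergence _ (.of_forall hmeas) ?_ hbint ?_
    · filter_upwards [hsmall] with δ hδ
      filter_upwards [ae_restrict_mem measurableSet_Ioi] with u hu
        using hbound δ hδ.1 hδ.2 u hu
    · filter_upwards [ae_restrict_mem measurableSet_Ioi] with u hu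
      have hu0 : 0 < u := hu
      refine Tendsto.mul_const _ ?_
      have hv : Tendsto (fun δ : ℝ => u / δ) (𝓝[>] 0) atTop :=
        tendsto_inv_nhdsGT_zero.const_mul_atTop hu0
      have hz : Tendsto (fun δ : ℝ => K / (u / δ)) (𝓝[>] 0) (𝓝 0) := hv.const_div_atTop K
      rw [tendsto_iff_norm_sub_tendsto_zero]
      refine squeeze_zero' (.of_forall fun _ => norm_nonneg _) ?_ hz
      filter_upwards [self_mem_nhdsWithin, (Real.tendsto_exp_atTop.comp hv).eventually_ge_atTop 2]
        with δ hδ hexp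
      have hδ0 : 0 < δ := hδ
      have h3 := h _ hexp
      simp only [Function.comp_apply] at h3
      rw [Real.log_exp, Real.log_div hu0.ne' hδ0.ne'] at h3
      rw [Real.norm_eq_abs]
      convert h3 using 2
      ring
  have hval : ∀ᶠ δ : ℝ in 𝓝[>] 0, ∫ u in Set.Ioi 0, F δ u =
      Real.log (riemannZeta ((1 + δ : ℝ) : ℂ)).re + Real.log δ +
        Real.eulerMascheroniConstant := by
    filter_upwards [hsmall] with δ hδ
    have hFint : IntegrableOn (F δ) (Set.Ioi 0) := by
      refine hbint.mono' (hmeas δ) ?_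
      filter_upwards [ae_restrict_mem measurableSet_Ioi] with u hu using hbound δ hδ.1 hδ.2 u hu
    have e : ∀ u : ℝ, vonMangoldtLogSum ⌊Real.exp (u / δ)⌋₊ * Real.exp (-u) =
        F δ u + Real.log u * Real.exp (-u) - Real.log δ * Real.exp (-u) := fun u => by
      simp only [hF]; ring
    rw [log_riemannZeta_one_add_eq_integral_exp hδ.1]
    simp_rw [e]
    have hadd : IntegrableOn (fun u => F δ u + Real.log u * Real.exp (-u)) (Set.Ioi 0) :=
      hFint.add integrableOn_log_mul_exp_neg
    rw [integral_sub hadd (hE.const_mul _),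
      integral_add hFint integrableOn_log_mul_exp_neg, integral_log_mul_exp_neg,
      integral_const_mul, integral_exp_neg_Ioi_zero]
    ring
  have hlim' := (tendsto_log_riemannZeta_add_log.add_const
    Real.eulerMascheroniConstant).congr' (hval.mono fun _ h => h.symm)
  have := tendsto_nhds_unique hlim hlim'
  rw [integral_const_mul, integral_exp_neg_Ioi_zero] at this
  linarith

/-- Mertens' theorem for `∑ Λ(n) / (n log n)`. -/
theorem exists_abs_vonMangoldtLogSum_sub_eulerMascheroni_le :
    ∃ K : ℝ, 0 ≤ K ∧ ∀ t : ℝ, 2 ≤ t → |vonMangoldtLogSum ⌊t⌋₊ - Real.log (Real.log t) -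
      Real.eulerMascheroniConstant| ≤ K / Real.log t := by
  obtain ⟨c, K, hK, h⟩ := exists_abs_vonMangoldtLogSum_floor_sub_le
  exact ⟨K, hK, vonMangoldtLogSum_constant_eq_eulerMascheroni hK h ▸ h⟩

theorem sum_primes_tsum_pow_le_tsum {f : ℕ → ℝ} (hf : Summable f) (hf0 : ∀ n, 0 ≤ f n)
    (hsupp : Function.support f ⊆ {n | IsPrimePow n}) (Y : ℕ) :
    ∑ p ∈ Ioc 0 Y with p.Prime, ∑' k : ℕ, f (p ^ (k + 1)) ≤ ∑' n, f n := by
  rw [tsum_eq_tsum_primes_of_support_subset_prime_powers hf hsupp]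
  have hinj : Function.Injective fun i : Nat.Primes × ℕ => (i.1 : ℕ) ^ (i.2 + 1) := fun i j hij =>
    Nat.Primes.prodNatEquiv.injective (Subtype.ext hij)
  have hsum : Summable fun p : Nat.Primes => ∑' k : ℕ, f ((p : ℕ) ^ (k + 1)) :=
    (hf.comp_injective hinj).prod
  have hle := Summable.sum_le_tsum (f := fun p : Nat.Primes => ∑' k : ℕ, f ((p : ℕ) ^ (k + 1)))
    ((Ioc 0 Y).subtype Nat.Prime) (fun p _ => tsum_nonneg fun k => hf0 _) hsum
  refine le_trans (le_of_eq ?_) hle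
  exact (Finset.sum_subtype_eq_sum_filter (fun p => ∑' k : ℕ, f (p ^ (k + 1)))).symm

theorem neg_log_sub_le_tsum_truncated {p : ℕ} (hp : 2 ≤ p) {w : ℂ} (hw : ‖w‖ ≤ 1 / p)
    {X : ℝ} (hX : 0 < X) :
    -Real.log (1 - 1 / p) - Real.log ‖1 - w‖ - 6 / √X ≤
      ∑' k : ℕ, if ((p ^ (k + 1) : ℕ) : ℝ) ≤ X then
        ((1 / (p : ℝ)) ^ (k + 1) + (w ^ (k + 1)).re) / (k + 1) else 0 := by
  have hp' : (2 : ℝ) ≤ p := by exact_mod_cast hp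
  have hp0 : (0 : ℝ) < p := by linarith
  have hpinv : 1 / (p : ℝ) ≤ 1 / 2 := one_div_le_one_div_of_le two_pos hp'
  have hpinv0 : 0 < 1 / (p : ℝ) := by positivity
  set a : ℕ → ℝ := fun k => ((1 / (p : ℝ)) ^ (k + 1) + (w ^ (k + 1)).re) / (k + 1) with ha
  have hre : ∀ k, |(w ^ (k + 1)).re| ≤ (1 / (p : ℝ)) ^ (k + 1) := fun k =>
    (Complex.abs_re_le_norm _).trans (by
      rw [norm_pow]; exact pow_le_pow_left₀ (norm_nonneg _) hw _)
  have ha0 : ∀ k, 0 ≤ a k := fun k =>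
    div_nonneg (by linarith [(abs_le.1 (hre k)).1]) (by positivity)
  have hsum : HasSum a (-Real.log (1 - 1 / p) - Real.log ‖1 - w‖) := by
    have h1 := Real.hasSum_pow_div_log_of_abs_lt_one (x := 1 / (p : ℝ))
      (by rw [abs_of_pos hpinv0]; linarith)
    have h2 := Complex.hasSum_re
      (Complex.hasSum_taylorSeries_neg_log' (z := w) (by linarith))
    convert! h1.add h2 using 1
    · ext k
      have : (w ^ (k + 1) / ((k : ℂ) + 1)).re = (w ^ (k + 1)).re / (k + 1) := by
        have := Complex.div_natCast_re (w ^ (k + 1)) (k + 1)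
        push_cast at this
        exact this
      rw [this, ← add_div]
    · simp [Complex.log_re, sub_eq_add_neg]
  set u : ℝ := (√(p : ℝ))⁻¹ with hu
  have hsqrt0 : 0 < √(p : ℝ) := Real.sqrt_pos.2 hp0
  have hu0 : 0 < u := by positivity
  have husq : u ^ 2 = 1 / p := by
    rw [hu, inv_pow, Real.sq_sqrt hp0.le, one_div]
  have hu34 : u ≤ 3 / 4 := by nlinarith
  have hgeo : HasSum (fun k : ℕ => 2 / √X * u ^ (k + 1)) (2 / √X * ((1 - u)⁻¹ * u)) := by
    simp_rw [pow_succ]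
    exact ((hasSum_geometric_of_lt_one hu0.le (by linarith)).mul_right u).mul_left _
  have htrunc : Summable fun k : ℕ => if ((p ^ (k + 1) : ℕ) : ℝ) ≤ X then a k else 0 := by
    refine Summable.of_nonneg_of_le (fun k => ?_) (fun k => ?_) hsum.summable
    · split_ifs
      exacts [ha0 k, le_rfl]
    · split_ifs
      exacts [le_rfl, ha0 k]
  have hle : ∀ k, a k ≤ (if ((p ^ (k + 1) : ℕ) : ℝ) ≤ X then a k else 0) +
      2 / √X * u ^ (k + 1) := by
    intro k
    have hpos : 0 < 2 / √X * u ^ (k + 1) := by positivity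
    split_ifs with hk
    · linarith
    · rw [not_le] at hk
      have h1 : a k ≤ 2 * (1 / (p : ℝ)) ^ (k + 1) := by
        refine (div_le_self (by linarith [(abs_le.1 (hre k)).1])
          (by linarith [k.cast_nonneg (α := ℝ)])).trans ?_
        linarith [(abs_le.1 (hre k)).2]
      have h2 : u ^ (k + 1) ≤ 1 / √X := by
        rw [hu, inv_pow, ← one_div]
        refine one_div_le_one_div_of_le (Real.sqrt_pos.2 hX) (Real.sqrt_le_iff.2 ⟨by positivity, ?_⟩)
        rw [← pow_mul, mul_comm, pow_mul, Real.sq_sqrt hp0.le]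
        exact_mod_cast hk.le
      rw [← husq, ← pow_mul, mul_comm 2 (k + 1), pow_mul, sq] at h1
      have h3 := mul_le_mul_of_nonneg_right h2 (pow_pos hu0 (k + 1)).le
      have e : 2 / √X * u ^ (k + 1) = 2 * (1 / √X * u ^ (k + 1)) := by ring
      rw [e]
      linarith
  have hmain := hasSum_le hle hsum (htrunc.hasSum.add hgeo)
  have hbound : 2 / √X * ((1 - u)⁻¹ * u) ≤ 6 / √X := by
    have : (1 - u)⁻¹ * u ≤ 3 := by
      rw [inv_mul_le_iff₀ (by linarith)]; linarith
    calc 2 / √X * ((1 - u)⁻¹ * u) ≤ 2 / √X * 3 :=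
          mul_le_mul_of_nonneg_left this (by positivity)
      _ = 6 / √X := by ring
  linarith

theorem zeta_two_sub_le_sum_range {Y : ℕ} (hY : 0 < Y) :
    Real.pi ^ 2 / 6 - 1 / Y ≤ ∑ n ∈ range (Y + 1), (1 : ℝ) / (n : ℝ) ^ 2 := by
  have hanti : Antitone fun n : ℕ =>
      ∑ k ∈ range (n + 1 + 1), (1 : ℝ) / (k : ℝ) ^ 2 + 1 / ((n + 1 : ℕ) : ℝ) := by
    refine antitone_nat_of_succ_le fun n => ?_
    rw [sum_range_succ _ (n + 1 + 1)]
    have : (1 : ℝ) / ((n + 1 + 1 : ℕ) : ℝ) ^ 2 + 1 / ((n + 1 + 1 : ℕ) : ℝ) ≤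
        1 / ((n + 1 : ℕ) : ℝ) := by
      push_cast
      rw [div_add_div _ _ (by positivity) (by positivity),
        div_le_div_iff₀ (by positivity) (by positivity)]
      nlinarith [n.cast_nonneg (α := ℝ), sq_nonneg (n : ℝ),
        mul_nonneg n.cast_nonneg (sq_nonneg (n : ℝ))]
    linarith
  have hlim : Filter.Tendsto (fun n : ℕ =>
      ∑ k ∈ range (n + 1 + 1), (1 : ℝ) / (k : ℝ) ^ 2 + 1 / ((n + 1 : ℕ) : ℝ)) Filter.atTop
      (nhds (Real.pi ^ 2 / 6)) := by
    have h1 := (Filter.tendsto_add_atTop_iff_nat 2).2 hasSum_zeta_two.tendsto_sum_nat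
    have h2 := tendsto_one_div_add_atTop_nhds_zero_nat (𝕜 := ℝ)
    simpa using h1.add h2
  obtain ⟨m, rfl⟩ := Nat.exists_eq_add_of_le' hY
  have := hanti.le_of_tendsto hlim m
  linarith

theorem sum_range_le_prod_primes (Y : ℕ) :
    ∑ n ∈ range (Y + 1), (1 : ℝ) / (n : ℝ) ^ 2 ≤
      ∏ p ∈ Ioc 0 Y with p.Prime, (1 - 1 / (p : ℝ) ^ 2)⁻¹ := by
  let f : ℕ →* ℝ :=
    { toFun := fun n => 1 / (n : ℝ) ^ 2
      map_one' := by simp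
      map_mul' := fun m n => by push_cast; rw [mul_pow, one_div_mul_one_div] }
  have hf : ∀ {p : ℕ}, p.Prime → ‖f p‖ < 1 := fun {p} hp => by
    have : (2 : ℝ) ≤ p := by exact_mod_cast hp.two_le
    change ‖1 / (p : ℝ) ^ 2‖ < 1
    rw [Real.norm_of_nonneg (by positivity), div_lt_one (by positivity)]
    nlinarith
  have h := (EulerProduct.summable_and_hasSum_smoothNumbers_prod_primesBelow_geometric
    (f := f) hf (Y + 1)).2
  have hset : (Y + 1).primesBelow = (Ioc 0 Y).filter Nat.Prime := by
    ext p
    simp only [Nat.mem_primesBelow, mem_filter, mem_Ioc]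
    exact ⟨fun h => ⟨⟨h.2.pos, by omega⟩, h.2⟩, fun h => ⟨by omega, h.2⟩⟩
  rw [hset] at h
  have hle := sum_le_hasSum ((range (Y + 1)).subtype (· ∈ (Y + 1).smoothNumbers))
    (fun i _ => by change 0 ≤ 1 / ((i : ℕ) : ℝ) ^ 2; positivity) h
  refine le_trans (le_of_eq ?_) hle
  rw [Finset.sum_subtype_eq_sum_filter (fun n => f n), sum_filter]
  refine sum_congr rfl fun n hn => ?_
  split_ifs with hs
  · rfl
  · rcases Nat.eq_zero_or_pos n with rfl | hn0
    · simp
    · exact absurd (Nat.mem_smoothNumbers_of_lt hn0 (mem_range.1 hn)) hs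

theorem log_zeta_two_sub_le_sum_primes {Y : ℕ} (hY : 0 < Y) :
    Real.log (Real.pi ^ 2 / 6) - 1 / Y ≤
      ∑ p ∈ Ioc 0 Y with p.Prime, -Real.log (1 - 1 / (p : ℝ) ^ 2) := by
  have hfac : ∀ p ∈ (Ioc 0 Y).filter Nat.Prime, 1 ≤ (1 - 1 / (p : ℝ) ^ 2)⁻¹ := fun p hp => by
    have hp2 : (2 : ℝ) ≤ p := by exact_mod_cast (mem_filter.1 hp).2.two_le
    have h1 : 1 / (p : ℝ) ^ 2 < 1 := by
      rw [div_lt_one (by positivity)]; nlinarith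
    exact (one_le_inv₀ (by linarith)).2 (by linarith [show 0 < 1 / (p : ℝ) ^ 2 by positivity])
  have hP1 : 1 ≤ ∏ p ∈ Ioc 0 Y with p.Prime, (1 - 1 / (p : ℝ) ^ 2)⁻¹ := Finset.one_le_prod hfac
  have hlog : ∑ p ∈ Ioc 0 Y with p.Prime, -Real.log (1 - 1 / (p : ℝ) ^ 2) =
      Real.log (∏ p ∈ Ioc 0 Y with p.Prime, (1 - 1 / (p : ℝ) ^ 2)⁻¹) := by
    rw [Real.log_prod fun p hp => (one_pos.trans_le (hfac p hp)).ne']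
    simp_rw [Real.log_inv]
  have hle := (zeta_two_sub_le_sum_range hY).trans (sum_range_le_prod_primes Y)
  rw [hlog]
  generalize ∏ p ∈ Ioc 0 Y with p.Prime, (1 - 1 / (p : ℝ) ^ 2)⁻¹ = P at *
  have hP0 : 0 < P := by linarith
  have hZ : 0 < Real.pi ^ 2 / 6 := by positivity
  have h1 := Real.log_le_sub_one_of_pos (div_pos hZ hP0)
  rw [Real.log_div hZ.ne' hP0.ne'] at h1
  have h2 : Real.pi ^ 2 / 6 / P - 1 ≤ 1 / Y := by
    rw [sub_le_iff_le_add, div_le_iff₀ hP0]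
    have : (0 : ℝ) ≤ 1 / Y := by positivity
    nlinarith
  linarith

theorem sum_primes_le_vonMangoldtLogSum_add {c : ℕ → ℂ} (hc : ∀ n, ‖c n‖ ≤ 1 / n)
    (hpow : ∀ p k : ℕ, c (p ^ k) = c p ^ k) {X : ℝ} (hX : 0 < X) (Y : ℕ) :
    ∑ p ∈ Ioc 0 Y with p.Prime, (-Real.log (1 - 1 / p) - Real.log ‖1 - c p‖ - 6 / √X) ≤
      vonMangoldtLogSum ⌊X⌋₊ +
        ∑ n ∈ Ioc 0 ⌊X⌋₊, ArithmeticFunction.vonMangoldt n / Real.log n * (c n).re := by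
  set g : ℕ → ℝ := fun n => if (n : ℝ) ≤ X then
    ArithmeticFunction.vonMangoldt n / Real.log n * (1 / n + (c n).re) else 0 with hg
  have hg0 : ∀ n, 0 ≤ g n := fun n => by
    simp only [hg]
    split_ifs
    · refine mul_nonneg (div_nonneg ArithmeticFunction.vonMangoldt_nonneg
        (Real.log_natCast_nonneg n)) ?_
      linarith [(abs_le.1 ((Complex.abs_re_le_norm (c n)).trans (hc n))).1]
    · exact le_rfl
  have hout : ∀ n ∉ Ioc 0 ⌊X⌋₊, g n = 0 := fun n hn => by
    rcases Nat.eq_zero_or_pos n with rfl | hn0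
    · simp [hg]
    · simp only [hg]
      rw [if_neg]
      intro h
      exact hn (mem_Ioc.2 ⟨hn0, Nat.le_floor h⟩)
  have hsupp : Function.support g ⊆ {n | IsPrimePow n} := fun n hn => by
    by_contra h
    refine hn ?_
    simp [hg, ArithmeticFunction.vonMangoldt_eq_zero_iff.2 h]
  have htsum : ∑' n, g n = vonMangoldtLogSum ⌊X⌋₊ +
      ∑ n ∈ Ioc 0 ⌊X⌋₊, ArithmeticFunction.vonMangoldt n / Real.log n * (c n).re := by
    rw [tsum_eq_sum hout, vonMangoldtLogSum, ← sum_add_distrib]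
    refine sum_congr rfl fun n hn => ?_
    simp only [hg]
    rw [if_pos ((Nat.le_floor_iff hX.le).1 (mem_Ioc.1 hn).2), mul_add, div_mul_div_comm, mul_one,
      mul_comm (Real.log n)]
  rw [← htsum]
  refine le_trans (sum_le_sum fun p hp => ?_) (sum_primes_tsum_pow_le_tsum
    (summable_of_ne_finset_zero hout) hg0 hsupp Y)
  have hpp : p.Prime := (mem_filter.1 hp).2
  refine (neg_log_sub_le_tsum_truncated hpp.two_le (hc p) hX).trans (le_of_eq ?_)
  refine tsum_congr fun k => ?_
  have hlog : Real.log p ≠ 0 := (Real.log_pos (by exact_mod_cast hpp.one_lt)).ne'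
  simp only [hg]
  split_ifs
  · rw [ArithmeticFunction.vonMangoldt_apply_pow k.succ_ne_zero,
      ArithmeticFunction.vonMangoldt_apply_prime hpp, hpow]
    push_cast
    rw [Real.log_pow, one_div_pow]
    push_cast
    have : (k : ℝ) + 1 ≠ 0 := by positivity
    field_simp
  · rfl

theorem re_sum_vonMangoldt_mul_div_eq {q : ℕ} (χ : DirichletCharacter ℂ q) (s : ℂ) (N : ℕ) :
    (∑ n ∈ Ioc 1 N, (ArithmeticFunction.vonMangoldt n : ℂ) * χ (n : ZMod q) /
        ((n : ℂ) ^ s * (Real.log n : ℂ))).re =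
      ∑ n ∈ Ioc 0 N, ArithmeticFunction.vonMangoldt n / Real.log n *
        (χ (n : ZMod q) / (n : ℂ) ^ s).re := by
  rw [Complex.re_sum]
  refine (sum_congr rfl fun n _ => ?_).trans (sum_subset (Ioc_subset_Ioc_left zero_le_one) ?_)
  · rw [← Complex.re_ofReal_mul]
    push_cast
    congr 1
    rw [div_mul_div_comm, mul_comm ((n : ℂ) ^ s)]
  · intro n hn hn'
    obtain rfl : n = 1 := by
      simp only [mem_Ioc] at hn hn'
      omega
    simp

theorem norm_dirichletCharacter_div_cpow_le {q : ℕ} (χ : DirichletCharacter ℂ q) {s : ℂ}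
    (hs : 1 ≤ s.re) (n : ℕ) : ‖χ (n : ZMod q) / (n : ℂ) ^ s‖ ≤ 1 / n := by
  rcases Nat.eq_zero_or_pos n with rfl | hn
  · have : s ≠ 0 := fun h => by simp [h] at hs; linarith
    simp [Complex.zero_cpow this]
  · have hn1 : (1 : ℝ) ≤ n := by exact_mod_cast hn
    rw [norm_div, Complex.norm_natCast_cpow_of_pos hn]
    refine div_le_div₀ zero_le_one (χ.norm_le_one _) (by positivity) ?_
    simpa using Real.rpow_le_rpow_of_exponent_le hn1 hs

theorem dirichletCharacter_div_cpow_pow {q : ℕ} (χ : DirichletCharacter ℂ q) (s : ℂ) (p k : ℕ) :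
    χ ((p ^ k : ℕ) : ZMod q) / ((p ^ k : ℕ) : ℂ) ^ s = (χ (p : ZMod q) / (p : ℂ) ^ s) ^ k := by
  rw [Nat.cast_pow, map_pow, div_pow, Nat.cast_pow, ← Complex.natCast_cpow_natCast_mul,
    Complex.cpow_nat_mul]

theorem neg_log_one_sub_inv_sq_add_le {q : ℕ} (χ : DirichletCharacter ℂ q) {s : ℂ} (hs : 1 ≤ s.re) {p : ℕ}
    (hp : p.Prime) :
    -Real.log (1 - 1 / (p : ℝ) ^ 2) + (if p ∣ q then Real.log (((p : ℝ) + 1) / p) else 0) ≤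
      -Real.log (1 - 1 / p) - Real.log ‖1 - χ (p : ZMod q) / (p : ℂ) ^ s‖ := by
  have hp2 : (2 : ℝ) ≤ p := by exact_mod_cast hp.two_le
  have hpinv : 1 / (p : ℝ) ≤ 1 / 2 := one_div_le_one_div_of_le two_pos hp2
  have hpinv0 : 0 < 1 / (p : ℝ) := by positivity
  have h1 : 0 < 1 - 1 / (p : ℝ) := by linarith
  have h2 : 0 < 1 + 1 / (p : ℝ) := by linarith
  have hfac : 1 - 1 / (p : ℝ) ^ 2 = (1 - 1 / p) * (1 + 1 / p) := by ring
  have hdiv : ((p : ℝ) + 1) / p = 1 + 1 / p := by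
    rw [add_div, div_self (by positivity)]
  rw [hfac, Real.log_mul h1.ne' h2.ne', hdiv]
  split_ifs with hpq
  · have : χ (p : ZMod q) = 0 := χ.map_nonunit fun h =>
      (Nat.Prime.coprime_iff_not_dvd hp).1 ((ZMod.isUnit_iff_coprime p q).1 h) hpq
    simp [this]
  · have hw := norm_dirichletCharacter_div_cpow_le χ hs p
    generalize χ (p : ZMod q) / (p : ℂ) ^ s = w at *
    have hlow : 0 < ‖1 - w‖ := by
      have := norm_sub_norm_le 1 w
      rw [norm_one] at this
      linarith
    have hup : ‖1 - w‖ ≤ 1 + 1 / p := by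
      have := norm_sub_le 1 w
      rw [norm_one] at this
      linarith
    linarith [Real.log_le_log hlow hup]

theorem sum_primeFactors_log_le (q : ℕ) {z : ℝ} (hz : 0 < z) :
    ∑ p ∈ q.primeFactors, Real.log (((p : ℝ) + 1) / p) - q / z ≤
      ∑ p ∈ Ioc 0 ⌊z⌋₊ with p.Prime,
        if p ∣ q then Real.log (((p : ℝ) + 1) / p) else 0 := by
  rcases Nat.eq_zero_or_pos q with rfl | hq
  · simp only [Nat.primeFactors_zero, sum_empty, Nat.cast_zero, zero_div, sub_zero]
    refine sum_nonneg fun p hp => ?_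
    have : (0 : ℝ) < p := by exact_mod_cast (mem_filter.1 hp).2.pos
    rw [if_pos (dvd_zero p)]
    exact Real.log_nonneg ((one_le_div this).2 (by linarith))
  rw [← sum_filter, filter_filter]
  have hset : (Ioc 0 ⌊z⌋₊).filter (fun p => p.Prime ∧ p ∣ q) =
      q.primeFactors.filter (· ≤ ⌊z⌋₊) := by
    ext p
    simp only [mem_filter, mem_Ioc, Nat.mem_primeFactors]
    exact ⟨fun h => ⟨⟨h.2.1, h.2.2, hq.ne'⟩, h.1.2⟩, fun h => ⟨⟨h.1.1.pos, h.2⟩, h.1.1, h.1.2.1⟩⟩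
  rw [hset, ← sum_filter_add_sum_filter_not q.primeFactors (· ≤ ⌊z⌋₊)]
  have hrest : ∑ p ∈ q.primeFactors with ¬p ≤ ⌊z⌋₊, Real.log (((p : ℝ) + 1) / p) ≤ q / z := by
    have hle : ∀ p ∈ q.primeFactors.filter (¬ · ≤ ⌊z⌋₊),
        Real.log (((p : ℝ) + 1) / p) ≤ 1 / z := fun p hp => by
      obtain ⟨hp1, hp2⟩ := mem_filter.1 hp
      have hzp : z < p := (Nat.floor_lt hz.le).1 (not_le.1 hp2)
      have hp0 : (0 : ℝ) < p := hz.trans hzp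
      have h := Real.log_le_sub_one_of_pos (show 0 < ((p : ℝ) + 1) / p by positivity)
      rw [add_div, div_self hp0.ne'] at h ⊢
      linarith [one_div_le_one_div_of_le hz hzp.le]
    refine (sum_le_card_nsmul _ _ _ hle).trans ?_
    rw [nsmul_eq_mul, mul_one_div]
    refine div_le_div_of_nonneg_right ?_ hz.le
    have hcard : (q.primeFactors.filter (¬ · ≤ ⌊z⌋₊)).card ≤ (Ioc 0 q).card :=
      card_le_card fun p hp => mem_Ioc.2
        ⟨(Nat.prime_of_mem_primeFactors (mem_filter.1 hp).1).pos,
          Nat.le_of_mem_primeFactors (mem_filter.1 hp).1⟩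
    rw [Nat.card_Ioc, Nat.sub_zero] at hcard
    exact_mod_cast hcard
  linarith

/-- For a primitive character `χ` mod `q`, `x ≥ 3` and `Re s ≥ 1`,
`Re ∑_{1 < n ≤ x} Λ(n) χ(n)/(n^s log n)
  ≥ −log log x − C₀ + log(π²/6) + ∑_{p ∣ q} log((p+1)/p) − O(1/log x)`. -/
theorem re_log_sum_lower (q : ℕ) (hq : 2 < q)
    (χ : DirichletCharacter ℂ q) (hχ : χ.IsPrimitive) :
    ∃ C : ℝ, 0 < C ∧
      ∀ x : ℝ, 3 ≤ x → ∀ s : ℂ, 1 ≤ s.re →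
        -Real.log (Real.log x) - Real.eulerMascheroniConstant +
            Real.log (Real.pi ^ 2 / 6) +
            (∑ p ∈ q.primeFactors, Real.log (((p : ℝ) + 1) / p)) - C / Real.log x ≤
          (∑ n ∈ Finset.Ioc 1 ⌊x⌋₊,
            (ArithmeticFunction.vonMangoldt n : ℂ) * χ (n : ZMod q) /
              ((n : ℂ) ^ s * (Real.log n : ℂ))).re := by
  obtain ⟨K, hK0, hK⟩ := exists_abs_vonMangoldtLogSum_sub_eulerMascheroni_le
  refine ⟨K + 4 * (q + 8), by positivity, fun x hx s hs => ?_⟩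
  have hx0 : 0 < x := by linarith
  have hx1 : 1 ≤ √x := Real.one_le_sqrt.2 (by linarith)
  set z : ℝ := √√x with hz
  have hz1 : 1 ≤ z := Real.one_le_sqrt.2 hx1
  have hz0 : 0 < z := by linarith
  have hzsq : √x = z ^ 2 := (Real.sq_sqrt (by linarith)).symm
  have hY : 0 < ⌊z⌋₊ := Nat.floor_pos.2 hz1
  have hYz : (⌊z⌋₊ : ℝ) ≤ z := Nat.floor_le hz0.le
  have hzY : z < ⌊z⌋₊ + 1 := Nat.lt_floor_add_one z
  have hY1 : (1 : ℝ) ≤ ⌊z⌋₊ := by exact_mod_cast hY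
  have hlogx : 0 < Real.log x := Real.log_pos (by linarith)
  have hlog : Real.log x ≤ 4 * z := by
    have : x = z ^ 4 := by
      rw [show z ^ 4 = (z ^ 2) ^ 2 by ring, ← hzsq, Real.sq_sqrt hx0.le]
    rw [this, Real.log_pow]
    push_cast
    linarith [Real.log_le_sub_one_of_pos hz0]
  have hinv : 1 / z ≤ 4 / Real.log x := by
    rw [div_le_div_iff₀ hz0 hlogx]
    linarith
  have hmain := sum_primes_le_vonMangoldtLogSum_add (norm_dirichletCharacter_div_cpow_le χ hs)
    (dirichletCharacter_div_cpow_pow χ s) hx0 ⌊z⌋₊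
  rw [← re_sum_vonMangoldt_mul_div_eq, sum_sub_distrib] at hmain
  have hlocal := sum_le_sum fun p (hp : p ∈ (Ioc 0 ⌊z⌋₊).filter Nat.Prime) =>
    neg_log_one_sub_inv_sq_add_le χ hs (mem_filter.1 hp).2
  rw [sum_add_distrib] at hlocal
  have herr : ∑ p ∈ Ioc 0 ⌊z⌋₊ with p.Prime, 6 / √x ≤ 6 * (1 / z) := by
    rw [sum_const, nsmul_eq_mul]
    have hcard : (((Ioc 0 ⌊z⌋₊).filter Nat.Prime).card : ℝ) ≤ z := by
      refine le_trans ?_ hYz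
      exact_mod_cast (card_filter_le _ _).trans (by simp)
    calc _ ≤ z * (6 / √x) := mul_le_mul_of_nonneg_right hcard (by positivity)
      _ = 6 * (1 / z) := by rw [hzsq]; field_simp
  have hzeta := log_zeta_two_sub_le_sum_primes hY
  have hYinv : (1 : ℝ) / ⌊z⌋₊ ≤ 2 * (1 / z) := by
    rw [mul_one_div, div_le_div_iff₀ (by linarith) hz0]
    linarith
  have hpf := sum_primeFactors_log_le q hz0
  have hG := (abs_le.1 (hK x (by linarith))).2
  have hC : (K + 4 * (q + 8)) / Real.log x = K / Real.log x + (q + 8) * (4 / Real.log x) := by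
    ring
  have hqz : (q : ℝ) / z = q * (1 / z) := by ring
  have hfinal := mul_le_mul_of_nonneg_left hinv (show (0 : ℝ) ≤ q + 8 by positivity)
  rw [hC]
  rw [hqz] at hpf
  linarith
end

section
/- Let χ be a non-principal Dirichlet character modulo q. There exists a constant C > 0 (depending only on q and χ) such that for all reals y₁, y₂ with 2 ≤ y₁ ≤ y₂, one has |∑_{y₁ < p ≤ y₂, p prime} χ(p)/p| ≤ C/log y₁. -/
open Complex DirichletCharacter Finset

/-- Abel summation bound: a weighted sum with nonnegative antitone weights is at most the first
weight times a bound for the unweighted partial sums. -/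
theorem norm_sum_Ioc_mul_le_of_antitone {f : ℕ → ℝ} {a : ℕ → ℂ} {B : ℝ} {N : ℕ}
    (hf : ∀ n, N < n → f (n + 1) ≤ f n) (hf₀ : ∀ n, N < n → 0 ≤ f n)
    (ha : ∀ n, ‖∑ k ∈ Ioc N n, a k‖ ≤ B) (M : ℕ) :
    ‖∑ n ∈ Ioc N M, (f n : ℂ) * a n‖ ≤ B * f (N + 1) := by
  have hB : 0 ≤ B := (norm_nonneg _).trans (ha 0)
  rcases le_or_gt M N with hMN | hMN
  · simpa [Ioc_eq_empty_of_le hMN] using mul_nonneg hB (hf₀ (N + 1) N.lt_succ_self)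
  have key : ‖∑ n ∈ Ioc N M, (f n : ℂ) * a n - f M * ∑ n ∈ Ioc N M, a n‖
      ≤ B * (f (N + 1) - f M) := by
    induction M, hMN using Nat.le_induction with
    | base => simp
    | succ M hM ih =>
      have hM' : N < M := hM
      have hid : ∑ n ∈ Ioc N (M + 1), (f n : ℂ) * a n - f (M + 1) * ∑ n ∈ Ioc N (M + 1), a n
          = (∑ n ∈ Ioc N M, (f n : ℂ) * a n - f M * ∑ n ∈ Ioc N M, a n)
            + ((f M - f (M + 1) : ℝ) : ℂ) * ∑ n ∈ Ioc N M, a n := by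
        rw [sum_Ioc_succ_top hM'.le, sum_Ioc_succ_top hM'.le]
        push_cast
        ring
      have hd : 0 ≤ f M - f (M + 1) := sub_nonneg.2 (hf M hM')
      calc _ ≤ B * (f (N + 1) - f M) + (f M - f (M + 1)) * B := by
            rw [hid]
            refine (norm_add_le _ _).trans (add_le_add ih ?_)
            rw [norm_mul, norm_real, Real.norm_of_nonneg hd]
            exact mul_le_mul_of_nonneg_left (ha M) hd
        _ = _ := by ring
  have h₀ := hf₀ M hMN
  calc _ ≤ ‖∑ n ∈ Ioc N M, (f n : ℂ) * a n - f M * ∑ n ∈ Ioc N M, a n‖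
        + ‖(f M : ℂ) * ∑ n ∈ Ioc N M, a n‖ := by
        simpa using norm_add_le
          (∑ n ∈ Ioc N M, (f n : ℂ) * a n - f M * ∑ n ∈ Ioc N M, a n)
          ((f M : ℂ) * ∑ n ∈ Ioc N M, a n)
    _ ≤ B * (f (N + 1) - f M) + f M * B := by
        refine add_le_add key ?_
        rw [norm_mul, norm_real, Real.norm_of_nonneg h₀]
        exact mul_le_mul_of_nonneg_left (ha M) h₀
    _ = _ := by ring

namespace DirichletCharacter

variable {q : ℕ} {χ : DirichletCharacter ℂ q}

theorem sum_Ioc_add_modulus_eq_zero [NeZero q] (hχ : χ ≠ 1) (N : ℕ) :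
    ∑ n ∈ Ioc N (N + q), χ (n : ZMod q) = 0 := by
  have hshift : ∑ n ∈ Ioc N (N + q), χ (n : ZMod q)
      = ∑ i ∈ range q, χ (((N + 1 : ℕ) : ZMod q) + (i : ZMod q)) := by
    have : Ioc N (N + q) = Ico (N + 1) (N + 1 + q) := by
      ext; simp; lia
    rw [this, sum_Ico_eq_sum_range]
    simp
  have hperiod : ∑ i ∈ range q, χ (((N + 1 : ℕ) : ZMod q) + (i : ZMod q))
      = ∑ x : ZMod q, χ (((N + 1 : ℕ) : ZMod q) + x) :=
    sum_bij' (fun i _ ↦ (i : ZMod q)) (fun x _ ↦ x.val) (fun _ _ ↦ mem_univ _)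
      (fun x _ ↦ mem_range.2 x.val_lt)
      (fun i hi ↦ ZMod.val_cast_of_lt (mem_range.1 hi))
      (fun x _ ↦ ZMod.natCast_zmod_val x) (fun _ _ ↦ rfl)
  rw [hshift, hperiod, ← MulChar.sum_eq_zero_of_ne_one hχ]
  exact Equiv.sum_comp (Equiv.addLeft ((N + 1 : ℕ) : ZMod q)) (fun x ↦ χ x)

theorem norm_sum_Ioc_le [NeZero q] (hχ : χ ≠ 1) (N M : ℕ) :
    ‖∑ n ∈ Ioc N M, χ (n : ZMod q)‖ ≤ q := by
  induction M using Nat.strong_induction_on with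
  | _ M ih =>
    rcases le_or_gt (N + q) M with h | h
    · have hq : 0 < q := NeZero.pos q
      rw [← Ioc_union_Ioc_eq_Ioc (show N ≤ M - q by lia) (Nat.sub_le M q),
        sum_union (Ioc_disjoint_Ioc_of_le le_rfl)]
      have := sum_Ioc_add_modulus_eq_zero hχ (M - q)
      rw [Nat.sub_add_cancel (by lia)] at this
      rw [this, add_zero]
      exact ih (M - q) (by lia)
    · calc _ ≤ ∑ n ∈ Ioc N M, (1 : ℝ) := norm_sum_le_of_le _ fun n _ ↦ χ.norm_le_one _
        _ ≤ q := by
          simp only [sum_const, Nat.card_Ioc, nsmul_eq_mul, mul_one, Nat.cast_le]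
          lia

theorem norm_sum_div_rpow_le [NeZero q] (hχ : χ ≠ 1) {s : ℝ} (hs : 1 ≤ s) (N M : ℕ) :
    ‖∑ n ∈ Ioc N M, LSeries.term (χ ·) s n‖ ≤ q / (N + 1) := by
  have h := norm_sum_Ioc_mul_le_of_antitone (f := fun n ↦ (n : ℝ) ^ (-s))
    (a := fun n ↦ χ (n : ZMod q)) (B := q) (N := N)
    (fun n hn ↦ Real.rpow_le_rpow_of_nonpos (by exact_mod_cast (by lia : 0 < n))
      (by push_cast; linarith) (by linarith))
    (fun n _ ↦ by positivity) (norm_sum_Ioc_le hχ N) M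
  refine le_trans (le_of_eq ?_) (h.trans ?_)
  · congr 1
    refine sum_congr rfl fun n hn ↦ ?_
    have hn0 : n ≠ 0 := by have := (mem_Ioc.1 hn).1; lia
    rw [LSeries.term_of_ne_zero hn0, ofReal_cpow n.cast_nonneg, div_eq_inv_mul]
    push_cast
    rw [cpow_neg]
  · rw [div_eq_mul_inv]
    refine mul_le_mul_of_nonneg_left ?_ q.cast_nonneg
    rw [← Real.rpow_neg_one]
    push_cast
    exact Real.rpow_le_rpow_of_exponent_le (by linarith [N.cast_nonneg (α := ℝ)]) (by linarith)

theorem norm_LFunction_sub_sum_le [NeZero q] (hχ : χ ≠ 1) {s : ℝ} (hs : 1 < s) (N : ℕ) :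
    ‖LFunction χ s - ∑ n ∈ Ioc 0 N, LSeries.term (χ ·) s n‖ ≤ q / (N + 1) := by
  have hs' : 1 < (s : ℂ).re := by simpa
  have hsum : Filter.Tendsto (fun M ↦ ∑ n ∈ range (M + 1), LSeries.term (χ ·) s n)
      Filter.atTop (nhds (LFunction χ s)) := by
    rw [LFunction_eq_LSeries χ hs']
    exact (LSeriesSummable_of_one_lt_re χ hs').LSeriesHasSum.tendsto_sum_nat.comp
      (Filter.tendsto_add_atTop_nat 1)
  refine le_of_tendsto (hsum.sub_const _).norm ?_
  filter_upwards [Filter.eventually_ge_atTop N] with M hM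
  have hrange : ∑ n ∈ range (M + 1), LSeries.term (χ ·) s n
      = ∑ n ∈ Ioc 0 M, LSeries.term (χ ·) s n := by
    rw [range_eq_Ico, sum_eq_sum_Ico_succ_bot M.succ_pos, LSeries.term_zero, zero_add]
    rfl
  rw [hrange, ← Ioc_union_Ioc_eq_Ioc N.zero_le hM, sum_union (Ioc_disjoint_Ioc_of_le le_rfl),
    add_sub_cancel_left]
  exact norm_sum_div_rpow_le hχ hs.le N M

theorem norm_LFunction_one_sub_sum_div_le [NeZero q] (hχ : χ ≠ 1) (N : ℕ) :
    ‖LFunction χ 1 - ∑ n ∈ Ioc 0 N, χ (n : ZMod q) / n‖ ≤ q / (N + 1) := by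
  have hcont : ContinuousAt
      (fun s : ℝ ↦ LFunction χ s - ∑ n ∈ Ioc 0 N, χ (n : ZMod q) / (n : ℂ) ^ (s : ℂ)) 1 := by
    refine ((differentiable_LFunction hχ).continuous.comp continuous_ofReal).continuousAt.sub
      (tendsto_finsetSum _ fun n hn ↦ ?_)
    have hn0 : (n : ℂ) ≠ 0 := by
      have := (mem_Ioc.1 hn).1
      exact_mod_cast this.ne'
    exact continuousAt_const.div
      (continuous_ofReal.continuousAt.const_cpow (Or.inl hn0)) (by simp [hn0])
  have hlim := (hcont.tendsto.mono_left (nhdsWithin_le_nhds (s := Set.Ioi 1))).norm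
  simp only [ofReal_one, cpow_one] at hlim
  refine le_of_tendsto hlim ?_
  filter_upwards [self_mem_nhdsWithin] with s hs
  convert! norm_LFunction_sub_sum_le hχ hs N using 3
  refine sum_congr rfl fun n hn ↦ ?_
  rw [LSeries.term_of_ne_zero (mem_Ioc.1 hn).1.ne']

theorem exists_norm_sum_log_div_le [NeZero q] (hχ : χ ≠ 1) :
    ∃ B : ℝ, ∀ N : ℕ, ‖∑ n ∈ Ioc 0 N, χ (n : ZMod q) * Real.log n / n‖ ≤ B := by
  have hexp : Real.exp 1 ≤ 3 := by linarith [Real.exp_one_lt_d9]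
  have htail := norm_sum_Ioc_mul_le_of_antitone (f := fun n ↦ Real.log n / n)
    (a := fun n ↦ χ (n : ZMod q)) (B := q) (N := 2)
    (fun n hn ↦ by
      have h3 : (3 : ℝ) ≤ n := by exact_mod_cast hn
      refine Real.log_div_self_antitoneOn ?_ ?_ ?_ <;> simp <;> linarith)
    (fun n _ ↦ by positivity) (norm_sum_Ioc_le hχ 2)
  refine ⟨‖∑ n ∈ Ioc (0 : ℕ) 2, χ (n : ZMod q) * Real.log n / n‖
    + q * (Real.log (2 + 1 : ℕ) / (2 + 1 : ℕ)), fun N ↦ ?_⟩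
  rcases le_or_gt 2 N with hN | hN
  · rw [← Ioc_union_Ioc_eq_Ioc (Nat.zero_le 2) hN, sum_union (Ioc_disjoint_Ioc_of_le le_rfl)]
    refine (norm_add_le _ _).trans (add_le_add le_rfl (le_trans (le_of_eq ?_) (htail N)))
    congr 1
    refine sum_congr rfl fun n _ ↦ ?_
    push_cast
    ring
  · have : ∑ n ∈ Ioc 0 N, χ (n : ZMod q) * Real.log n / n = 0 := by
      interval_cases N <;> simp
    rw [this, norm_zero]
    positivity

theorem sum_log_div_eq_sum_vonMangoldt_mul (χ : DirichletCharacter ℂ q) (N : ℕ) :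
    ∑ n ∈ Ioc 0 N, χ (n : ZMod q) * Real.log n / n
      = ∑ d ∈ Ioc 0 N, χ (d : ZMod q) * ArithmeticFunction.vonMangoldt d / d
          * ∑ m ∈ Ioc 0 (N / d), χ (m : ZMod q) / m := by
  let f : ArithmeticFunction ℂ :=
    ⟨fun n ↦ χ (n : ZMod q) * ArithmeticFunction.vonMangoldt n / n, by simp⟩
  let g : ArithmeticFunction ℂ := ⟨fun n ↦ χ (n : ZMod q) / n, by simp⟩
  refine Eq.trans (sum_congr rfl fun n _ ↦ ?_) (ArithmeticFunction.sum_Ioc_mul_eq_sum_sum f g N)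
  rw [ArithmeticFunction.mul_apply, ← ArithmeticFunction.vonMangoldt_sum,
    ← Nat.sum_divisorsAntidiagonal (fun i _ ↦ ArithmeticFunction.vonMangoldt i)]
  push_cast
  rw [mul_sum, sum_div]
  refine sum_congr rfl fun x hx ↦ ?_
  rw [← (Nat.mem_divisorsAntidiagonal.1 hx).1]
  change _ = χ (x.1 : ZMod q) * ArithmeticFunction.vonMangoldt x.1 / x.1 * (χ (x.2 : ZMod q) / x.2)
  push_cast
  rw [map_mul]
  ring

theorem exists_norm_sum_vonMangoldt_div_le [NeZero q] (hχ : χ ≠ 1) :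
    ∃ B : ℝ, ∀ N : ℕ,
      ‖∑ n ∈ Ioc 0 N, χ (n : ZMod q) * ArithmeticFunction.vonMangoldt n / n‖ ≤ B := by
  obtain ⟨B, hB⟩ := exists_norm_sum_log_div_le hχ
  have hL : 0 < ‖LFunction χ 1‖ := norm_pos_iff.2 (LFunction_apply_one_ne_zero hχ)
  refine ⟨(B + q * (Real.log 4 + 4)) / ‖LFunction χ 1‖, fun N ↦ ?_⟩
  rw [le_div_iff₀ hL, ← norm_mul]
  rcases N.eq_zero_or_pos with rfl | hN
  · have := (norm_nonneg _).trans (hB 0)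
    have := Real.log_nonneg (show (1 : ℝ) ≤ 4 by norm_num)
    simp only [Ioc_self, sum_empty, zero_mul, norm_zero]
    positivity
  have hN' : (0 : ℝ) < N := by exact_mod_cast hN
  have hid : (∑ n ∈ Ioc 0 N, χ (n : ZMod q) * ArithmeticFunction.vonMangoldt n / n)
        * LFunction χ 1
      = ∑ n ∈ Ioc 0 N, χ (n : ZMod q) * Real.log n / n
        + ∑ d ∈ Ioc 0 N, χ (d : ZMod q) * ArithmeticFunction.vonMangoldt d / d
          * (LFunction χ 1 - ∑ m ∈ Ioc 0 (N / d), χ (m : ZMod q) / m) := by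
    rw [sum_log_div_eq_sum_vonMangoldt_mul, ← sum_add_distrib, sum_mul]
    exact sum_congr rfl fun d _ ↦ by ring
  rw [hid]
  refine (norm_add_le _ _).trans (add_le_add (hB N) ?_)
  calc _ ≤ ∑ d ∈ Ioc 0 N, ArithmeticFunction.vonMangoldt d * (q / N) := by
        refine norm_sum_le_of_le _ fun d hd ↦ ?_
        have hd0 : (0 : ℝ) < d := by exact_mod_cast (mem_Ioc.1 hd).1
        have hΛ := ArithmeticFunction.vonMangoldt_nonneg (n := d)
        have hdiv : (N : ℝ) ≤ d * ((N / d : ℕ) + 1) := by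
          exact_mod_cast (Nat.lt_mul_div_succ N (mem_Ioc.1 hd).1).le
        rw [norm_mul, norm_div, norm_mul, norm_real, Real.norm_of_nonneg hΛ, norm_natCast]
        calc _ ≤ 1 * ArithmeticFunction.vonMangoldt d / d * (q / ((N / d : ℕ) + 1)) := by
              gcongr
              · exact χ.norm_le_one _
              · exact norm_LFunction_one_sub_sum_div_le hχ _
          _ = ArithmeticFunction.vonMangoldt d * (q / (d * ((N / d : ℕ) + 1))) := by
              field_simp
          _ ≤ _ := by gcongr
    _ = Chebyshev.psi N * (q / N) := by
        rw [← sum_mul, Chebyshev.psi, Nat.floor_natCast]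
    _ ≤ ((Real.log 4 + 4) * N) * (q / N) := by
        gcongr
        exact Chebyshev.psi_le_const_mul_self hN'.le
    _ = _ := by field_simp

theorem exists_norm_sum_prime_log_div_le [NeZero q] (hχ : χ ≠ 1) :
    ∃ B : ℝ, ∀ N M : ℕ,
      ‖∑ n ∈ Ioc N M, if n.Prime then χ (n : ZMod q) * Real.log n / n else 0‖ ≤ B := by
  obtain ⟨B, hB⟩ := exists_norm_sum_vonMangoldt_div_le hχ
  set h : ℕ → ℝ :=
    fun n ↦ (if n.Prime then 0 else ArithmeticFunction.vonMangoldt n) / n with hh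
  have hsum : Summable h := by
    convert! ArithmeticFunction.vonMangoldt.summable_residueClass_non_primes_div
      (q := 1) 0 using 4 with n
    simp [ArithmeticFunction.vonMangoldt.residueClass, Subsingleton.elim (n : ZMod 1) 0]
  have hnonneg (n : ℕ) : 0 ≤ h n := by
    simp only [hh]
    split_ifs
    · simp
    · exact div_nonneg ArithmeticFunction.vonMangoldt_nonneg n.cast_nonneg
  have hinit (N : ℕ) :
      ‖∑ n ∈ Ioc 0 N, if n.Prime then χ (n : ZMod q) * Real.log n / n else 0‖
        ≤ B + ∑' n, h n := by
    have hid : (∑ n ∈ Ioc 0 N, if n.Prime then χ (n : ZMod q) * Real.log n / n else 0)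
        = ∑ n ∈ Ioc 0 N, χ (n : ZMod q) * ArithmeticFunction.vonMangoldt n / n
          - ∑ n ∈ Ioc 0 N, χ (n : ZMod q) * h n := by
      rw [← sum_sub_distrib]
      refine sum_congr rfl fun n _ ↦ ?_
      by_cases hp : n.Prime
      · simp [hh, hp, ArithmeticFunction.vonMangoldt_apply_prime hp]
      · simp [hh, hp, mul_div_assoc]
    rw [hid]
    refine (norm_sub_le _ _).trans (add_le_add (hB N) ?_)
    refine (norm_sum_le_of_le _ fun n _ ↦ ?_).trans
      (hsum.sum_le_tsum (Ioc 0 N) fun n _ ↦ hnonneg n)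
    rw [norm_mul, norm_real, Real.norm_of_nonneg (hnonneg n)]
    exact mul_le_of_le_one_left (hnonneg n) (χ.norm_le_one _)
  refine ⟨(B + ∑' n, h n) + (B + ∑' n, h n), fun N M ↦ ?_⟩
  rcases le_total N M with hNM | hNM
  · rw [eq_sub_of_add_eq' (sum_Ioc_consecutive (M := ℂ) _ N.zero_le hNM)]
    exact (norm_sub_le _ _).trans (add_le_add (hinit M) (hinit N))
  · rw [Ioc_eq_empty_of_le hNM, sum_empty, norm_zero]
    have := (norm_nonneg _).trans (hinit 0)
    linarith

end DirichletCharacter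

/-- For a non-principal character `χ` mod `q` and `2 ≤ y₁ ≤ y₂`,
`∑_{y₁ < p ≤ y₂} χ(p)/p ≪ 1/log y₁`. -/
theorem char_sum_over_primes_small (q : ℕ) (hq : 2 < q)
    (χ : DirichletCharacter ℂ q) (hχ : χ ≠ 1) :
    ∃ C : ℝ, 0 < C ∧
      ∀ y₁ y₂ : ℝ, 2 ≤ y₁ → y₁ ≤ y₂ →
        ‖∑ p ∈ (Finset.Ioc ⌊y₁⌋₊ ⌊y₂⌋₊).filter Nat.Prime,
            χ (p : ZMod q) / (p : ℂ)‖ ≤ C / Real.log y₁ := by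
  have : NeZero q := ⟨by lia⟩
  obtain ⟨B, hB⟩ := exists_norm_sum_prime_log_div_le hχ
  have hB₀ : 0 ≤ B := (norm_nonneg _).trans (hB 0 0)
  refine ⟨B + 1, by linarith, fun y₁ y₂ hy₁ _ ↦ ?_⟩
  have hlog : 0 < Real.log y₁ := Real.log_pos (by linarith)
  have h2 : 2 ≤ ⌊y₁⌋₊ := Nat.le_floor (by exact_mod_cast hy₁)
  have hpos (n : ℕ) (hn : ⌊y₁⌋₊ < n) : 0 < Real.log n :=
    Real.log_pos (by exact_mod_cast (by lia : 1 < n))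
  have hAbel := norm_sum_Ioc_mul_le_of_antitone (f := fun n ↦ (Real.log n)⁻¹)
    (fun n hn ↦ inv_anti₀ (hpos n hn)
      (Real.log_le_log (by exact_mod_cast (by lia : 0 < n)) (by push_cast; linarith)))
    (fun n hn ↦ (inv_pos.2 (hpos n hn)).le) (hB ⌊y₁⌋₊) ⌊y₂⌋₊
  rw [sum_filter]
  calc _ ≤ B * (Real.log (⌊y₁⌋₊ + 1 : ℕ))⁻¹ := by
        refine le_trans (le_of_eq ?_) hAbel
        congr 1
        refine sum_congr rfl fun n hn ↦ ?_
        have hne : (Real.log n : ℂ) ≠ 0 := by exact_mod_cast (hpos n (mem_Ioc.1 hn).1).ne'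
        split_ifs
        · push_cast at hne ⊢
          field_simp
        · simp
    _ ≤ (B + 1) * (Real.log y₁)⁻¹ := by
        have hfloor : y₁ ≤ (⌊y₁⌋₊ + 1 : ℕ) := by exact_mod_cast (Nat.lt_floor_add_one y₁).le
        have := inv_anti₀ hlog (Real.log_le_log (by linarith) hfloor)
        gcongr
        linarith
    _ = _ := (div_eq_mul_inv _ _).symm
end
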